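/- Let φ be a circle covering map of degree two of class C² with positive derivative, with φ(0)=0, φ′(0)=1 and φ″(0)=0 (so that every element of the Thompson group T_φ is a C² diffeomorphism), and suppose φ is topologically conjugate to the doubling map x ↦ 2x (mod 1) (equivalently, the action of T_φ on the circle is minimal). Then the action of T_φ is ergodic with respect to Lebesgue measure: every Borel set A ⊆ ℝ/ℤ satisfying g(A) = A for all g ∈ T_φ has Lebesgue measure 0 or 1. -/

import Mathlib

open Set Filter MeasureTheory Topology

noncomputable section

/-- `F : ℝ → ℝ` is a lift of `φ : 𝕊¹ → 𝕊¹` witnessing that `φ` is a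
circle covering map of degree two. -/
def IsLiftDeg2 (φ : UnitAddCircle → UnitAddCircle) (F : ℝ → ℝ) : Prop :=
  Continuous F ∧ StrictMono F ∧ (∀ x : ℝ, F (x + 1) = F x + 2) ∧
    ∀ x : ℝ, φ (x : UnitAddCircle) = ((F x : ℝ) : UnitAddCircle)

/-- The closed arc on the circle starting at `a` (counterclockwise) of length `ℓ`. -/
def closedArc (a ℓ : ℝ) : Set UnitAddCircle :=
  (fun t : ℝ => (t : UnitAddCircle)) '' Set.Icc a (a + ℓ)

/-- The open arc on the circle starting at `a` (counterclockwise) of length `ℓ`. -/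
def openArc (a ℓ : ℝ) : Set UnitAddCircle :=
  (fun t : ℝ => (t : UnitAddCircle)) '' Set.Ioo a (a + ℓ)

/-- The open arc `(x, x + ε)` counterclockwise. -/
def rightArc (x : UnitAddCircle) (ε : ℝ) : Set UnitAddCircle :=
  {y | ∃ t : ℝ, 0 < t ∧ t < ε ∧ y = x + (t : UnitAddCircle)}

/-- The open arc `(x - ε, x)` counterclockwise. -/
def leftArc (x : UnitAddCircle) (ε : ℝ) : Set UnitAddCircle :=
  {y | ∃ t : ℝ, 0 < t ∧ t < ε ∧ y = x - (t : UnitAddCircle)}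

/-- `I` is a periodic interval of `φ` of period `s`: a proper nondegenerate closed arc
mapped onto itself homeomorphically by `φ^s`. -/
def IsPeriodicInterval (φ : UnitAddCircle → UnitAddCircle) (s : ℕ)
    (I : Set UnitAddCircle) : Prop :=
  1 ≤ s ∧ (∃ a ℓ : ℝ, 0 < ℓ ∧ ℓ < 1 ∧ I = closedArc a ℓ) ∧ Set.BijOn (φ^[s]) I I

/-- A maximal periodic interval of `φ`. -/
def IsMaxPeriodicInterval (φ : UnitAddCircle → UnitAddCircle)
    (I : Set UnitAddCircle) : Prop :=
  (∃ s, IsPeriodicInterval φ s I) ∧ ∀ J, (∃ s, IsPeriodicInterval φ s J) → I ⊆ J → I = J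

/-- `Λ = 𝕊¹ \ ⋃ₙ φ⁻ⁿ(I₁ ∪ ⋯ ∪ I_r)`, the complement of all preimages of the
maximal periodic intervals. -/
def lambdaSet (φ : UnitAddCircle → UnitAddCircle) : Set UnitAddCircle :=
  Set.univ \ ⋃ n : ℕ, (φ^[n]) ⁻¹' (⋃ I ∈ {I | IsMaxPeriodicInterval φ I}, I)

/-- The doubling map `x ↦ 2x (mod 1)`. -/
def doubling : UnitAddCircle → UnitAddCircle := fun x => x + x

/-- `φ` is topologically conjugate to the doubling map. -/
def ConjugateToDoubling (φ : UnitAddCircle → UnitAddCircle) : Prop :=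
  ∃ h : UnitAddCircle ≃ₜ UnitAddCircle, ∀ x, h (φ x) = doubling (h x)

/-- `I` is a `φ`-dyadic interval of degree `n` (described via the lift `F` of `φ`):
a closed arc whose endpoints are consecutive `φⁿ`-preimages of `0`. -/
def IsDyadic (F : ℝ → ℝ) (n : ℕ) (I : Set UnitAddCircle) : Prop :=
  ∃ a b : ℝ, a < b ∧ (∃ k : ℤ, F^[n] a = (k : ℝ)) ∧ F^[n] b = F^[n] a + 1 ∧
    I = (fun t : ℝ => (t : UnitAddCircle)) '' Set.Icc a b

/-- `G` is a lift of the orientation-preserving circle homeomorphism `g`. -/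
def IsOPLift (g : UnitAddCircle → UnitAddCircle) (G : ℝ → ℝ) : Prop :=
  Continuous G ∧ StrictMono G ∧ (∀ x : ℝ, G (x + 1) = G x + 1) ∧
    ∀ x : ℝ, g (x : UnitAddCircle) = ((G x : ℝ) : UnitAddCircle)

/-- `g` belongs to the Ghys–Sergiescu Thompson group `T_φ` (with `F` a lift of `φ`):
`g` is an orientation-preserving circle homeomorphism and there are partitions of the
circle into `φ`-dyadic intervals `I k`, `J k` such that `g` maps `I k` onto `J k` and
`g = φ_{J k}⁻¹ ∘ φ_{I k}` on `I k`, i.e. `φ^[m k] ∘ g = φ^[n k]` on `I k`. -/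
def InThompsonGroup (φ : UnitAddCircle → UnitAddCircle) (F : ℝ → ℝ)
    (g : UnitAddCircle → UnitAddCircle) : Prop :=
  (∃ G : ℝ → ℝ, IsOPLift g G) ∧
  ∃ (r : ℕ) (I J : Fin r → Set UnitAddCircle) (n m : Fin r → ℕ),
    0 < r ∧
    (∀ k, IsDyadic F (n k) (I k)) ∧ (∀ k, IsDyadic F (m k) (J k)) ∧
    (⋃ k, I k) = Set.univ ∧ (⋃ k, J k) = Set.univ ∧
    (Pairwise fun k l => interior (I k) ∩ interior (I l) = ∅) ∧
    (Pairwise fun k l => interior (J k) ∩ interior (J l) = ∅) ∧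
    (∀ k, g '' I k = J k) ∧ (∀ k, ∀ x ∈ I k, φ^[m k] (g x) = φ^[n k] x)

/-- `x` is a nonexpandable point for the action of `T_φ`: `g′(x) ≤ 1` for every
`g ∈ T_φ` (derivatives are computed via lifts). -/
def NonExpandable (φ : UnitAddCircle → UnitAddCircle) (F : ℝ → ℝ)
    (x : UnitAddCircle) : Prop :=
  ∀ g G, InThompsonGroup φ F g → IsOPLift g G →
    ∀ x' : ℝ, (x' : UnitAddCircle) = x → deriv G x' ≤ 1

/-- `I` is nice for `φ`: no forward iterate of the boundary returns to the interior. -/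
def IsNice (φ : UnitAddCircle → UnitAddCircle) (I : Set UnitAddCircle) : Prop :=
  ∀ n : ℕ, 1 ≤ n → (φ^[n]) '' (frontier I) ∩ interior I = ∅

/-- A nice interval: a proper nondegenerate closed arc that is nice. -/
def IsNiceInterval (φ : UnitAddCircle → UnitAddCircle) (I : Set UnitAddCircle) : Prop :=
  (∃ a ℓ : ℝ, 0 < ℓ ∧ ℓ < 1 ∧ I = closedArc a ℓ) ∧ IsNice φ I

/-- `J` is a connected component of `S`. -/
def IsComponentOf (J S : Set UnitAddCircle) : Prop :=
  ∃ x ∈ S, J = connectedComponentIn S x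

/-- The set of left endpoints of connected components of `𝕊¹ \ Λ`. -/
def leftEndpoints (Λ : Set UnitAddCircle) : Set UnitAddCircle :=
  {z | ∃ C : Set UnitAddCircle, IsComponentOf C (Set.univ \ Λ) ∧
    ∃ a ℓ : ℝ, 0 < ℓ ∧ ℓ ≤ 1 ∧ C = openArc a ℓ ∧ z = (a : UnitAddCircle)}

/-- The set of right endpoints of connected components of `𝕊¹ \ Λ`. -/
def rightEndpoints (Λ : Set UnitAddCircle) : Set UnitAddCircle :=
  {z | ∃ C : Set UnitAddCircle, IsComponentOf C (Set.univ \ Λ) ∧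
    ∃ a ℓ : ℝ, 0 < ℓ ∧ ℓ ≤ 1 ∧ C = openArc a ℓ ∧ z = ((a + ℓ : ℝ) : UnitAddCircle)}

/-- `x` is a parabolic periodic point of `φ`: `φ^s(x) = x` and `(φ^s)′(x) = 1`
(the derivative computed via the lift `F`). -/
def IsParabolicPeriodicPt (φ : UnitAddCircle → UnitAddCircle) (F : ℝ → ℝ)
    (x : UnitAddCircle) : Prop :=
  ∃ s : ℕ, 1 ≤ s ∧ φ^[s] x = x ∧
    ∀ x' : ℝ, (x' : UnitAddCircle) = x → deriv (F^[s]) x' = 1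

/-- A `C²` lift with positive derivative of a degree two circle map, normalized to fix `0`. -/
structure NormalizedLift (F : ℝ → ℝ) : Prop where
  contDiff : ContDiff ℝ 2 F
  deriv_pos : ∀ x, 0 < deriv F x
  map_add_one : ∀ x, F (x + 1) = F x + 2
  map_zero : F 0 = 0

namespace NormalizedLift

variable {F : ℝ → ℝ}

lemma continuous (hF : NormalizedLift F) : Continuous F := hF.contDiff.continuous

lemma differentiable (hF : NormalizedLift F) : Differentiable ℝ F :=
  hF.contDiff.differentiable (by norm_num)

lemma strictMono (hF : NormalizedLift F) : StrictMono F :=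
  strictMono_of_deriv_pos hF.deriv_pos

lemma iterate_strictMono (hF : NormalizedLift F) (n : ℕ) : StrictMono F^[n] :=
  hF.strictMono.iterate n

lemma iterate_continuous (hF : NormalizedLift F) (n : ℕ) : Continuous F^[n] :=
  hF.continuous.iterate n

lemma iterate_differentiable (hF : NormalizedLift F) (n : ℕ) : Differentiable ℝ F^[n] :=
  hF.differentiable.iterate n

lemma map_add_int (hF : NormalizedLift F) (x : ℝ) (m : ℤ) : F (x + m) = F x + 2 * m := by
  induction m using Int.induction_on with
  | zero => simp
  | succ i ih =>
    have := hF.map_add_one (x + i)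
    push_cast at ih ⊢
    rw [← add_assoc, this, ih]; ring
  | pred i ih =>
    have := hF.map_add_one (x + (-i - 1))
    push_cast at ih ⊢
    rw [show x + (-(i : ℝ) - 1) + 1 = x + -i by ring, ih] at this
    linarith

lemma iterate_add_int (hF : NormalizedLift F) (n : ℕ) (x : ℝ) (m : ℤ) :
    F^[n] (x + m) = F^[n] x + ((2 ^ n * m : ℤ) : ℝ) := by
  induction n generalizing x m with
  | zero => simp
  | succ n ih =>
    rw [Function.iterate_succ_apply, hF.map_add_int, Function.iterate_succ_apply]
    have := ih (F x) (2 * m)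
    push_cast at this ⊢
    rw [this]; ring

lemma iterate_int (hF : NormalizedLift F) (n : ℕ) (m : ℤ) :
    F^[n] (m : ℝ) = ((2 ^ n * m : ℤ) : ℝ) := by
  have h0 : F^[n] 0 = 0 := Function.iterate_fixed hF.map_zero n
  have := hF.iterate_add_int n 0 m
  rwa [h0, zero_add, zero_add] at this

lemma surjective (hF : NormalizedLift F) : Function.Surjective F := by
  intro y
  have h2 := hF.iterate_int 1 ⌈|y|⌉
  have h3 := hF.iterate_int 1 (-⌈|y|⌉)
  simp only [Function.iterate_one] at h2 h3
  push_cast at h2 h3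
  have e1 := Int.le_ceil |y|
  have e2 := le_abs_self y
  have e3 := neg_abs_le y
  have e4 := abs_nonneg y
  obtain ⟨x, -, hx⟩ := intermediate_value_Icc (a := -(⌈|y|⌉ : ℝ))
    (b := (⌈|y|⌉ : ℝ)) (f := F) (by linarith) hF.continuous.continuousOn
    (show y ∈ Icc _ _ from ⟨by linarith, by linarith⟩)
  exact ⟨x, hx⟩

lemma iterate_surjective (hF : NormalizedLift F) (n : ℕ) : Function.Surjective F^[n] :=
  hF.surjective.iterate n

lemma floor_eq_floor_iterate_ediv (hF : NormalizedLift F) (j : ℕ) (w : ℝ) :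
    ⌊w⌋ = ⌊F^[j] w⌋ / 2 ^ j := by
  have hp : (0 : ℤ) < 2 ^ j := by positivity
  have h1 : 2 ^ j * ⌊w⌋ ≤ ⌊F^[j] w⌋ := by
    rw [Int.le_floor, ← hF.iterate_int]
    exact (hF.iterate_strictMono j).monotone (Int.floor_le w)
  have h2 : ⌊F^[j] w⌋ < 2 ^ j * (⌊w⌋ + 1) := by
    rw [Int.floor_lt, ← hF.iterate_int]
    apply hF.iterate_strictMono j
    push_cast
    exact Int.lt_floor_add_one w
  apply le_antisymm
  · rw [Int.le_ediv_iff_mul_le hp]; linarith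
  · have : ⌊F^[j] w⌋ / 2 ^ j < ⌊w⌋ + 1 := by
      rw [Int.ediv_lt_iff_lt_mul hp]; linarith
    omega

lemma floor_iterate_add_int (hF : NormalizedLift F) (n : ℕ) (x : ℝ) (m : ℤ) :
    ⌊F^[n] (x + m)⌋ = ⌊F^[n] x⌋ + 2 ^ n * m := by
  rw [hF.iterate_add_int, Int.floor_add_intCast]

lemma deriv_periodic (hF : NormalizedLift F) : Function.Periodic (deriv F) 1 := by
  intro x
  have : (fun y => F (y + 1)) = fun y => F y + 2 := funext hF.map_add_one
  rw [← deriv_comp_add_const, this, deriv_add_const]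

lemma exists_lipschitz_log_deriv (hF : NormalizedLift F) :
    ∃ L : ℝ, 0 ≤ L ∧ ∀ x y, Real.log (deriv F x) ≤ L * |x - y| + Real.log (deriv F y) := by
  set g : ℝ → ℝ := fun x => Real.log (deriv F x) with hg
  have hd : ContDiff ℝ 1 (deriv F) := by
    have := hF.contDiff
    rw [show (2 : WithTop ℕ∞) = 1 + 1 by norm_num, contDiff_succ_iff_deriv] at this
    exact this.2.2
  have hgc : ContDiff ℝ 1 g := hd.log fun x => (hF.deriv_pos x).ne'
  have hper : Function.Periodic (deriv g) 1 := by
    intro x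
    have : (fun y => g (y + 1)) = g := by
      funext y; simp only [hg]; rw [hF.deriv_periodic y]
    rw [← deriv_comp_add_const, this]
  obtain ⟨L, hL⟩ := (hper.isBounded_of_continuous one_ne_zero
    (hgc.continuous_deriv le_rfl)).exists_norm_le
  have hL' : ∀ x, ‖deriv g x‖ ≤ L := fun x => hL _ (mem_range_self x)
  refine ⟨L, (norm_nonneg _).trans (hL' 0), fun x y => ?_⟩
  have := convex_univ.norm_image_sub_le_of_norm_deriv_le (f := g)
    (fun x _ => (hgc.differentiable (by norm_num)) x) (fun x _ => hL' x) (mem_univ y) (mem_univ x)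
  rw [Real.norm_eq_abs, Real.norm_eq_abs] at this
  have := (le_abs_self _).trans this
  simp only [hg] at this
  linarith

lemma deriv_iterate_pos (hF : NormalizedLift F) (n : ℕ) (x : ℝ) : 0 < deriv F^[n] x := by
  induction n generalizing x with
  | zero => simp
  | succ n ih =>
    rw [Function.iterate_succ, deriv_comp _ (hF.iterate_differentiable n _) (hF.differentiable x)]
    exact mul_pos (ih _) (hF.deriv_pos x)

/-- Bounded distortion of `F^[n]` on an interval, in terms of the total length of its iterates. -/
lemma deriv_iterate_le (hF : NormalizedLift F) {L : ℝ} (hL0 : 0 ≤ L)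
    (hL : ∀ x y, Real.log (deriv F x) ≤ L * |x - y| + Real.log (deriv F y))
    (n : ℕ) {t r x y : ℝ} (hx : x ∈ Icc t r) (hy : y ∈ Icc t r) :
    deriv F^[n] x ≤
      Real.exp (L * ∑ i ∈ Finset.range n, (F^[i] r - F^[i] t)) * deriv F^[n] y := by
  induction n generalizing t r x y with
  | zero => simp
  | succ n ih =>
    have hm := hF.strictMono.monotone
    have h1 := ih (t := F t) (r := F r) (x := F x) (y := F y)
      ⟨hm hx.1, hm hx.2⟩ ⟨hm hy.1, hm hy.2⟩
    have h2 : deriv F x ≤ Real.exp (L * (r - t)) * deriv F y := by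
      have h3 := hL x y
      have h4 : |x - y| ≤ r - t :=
        abs_le.2 ⟨by linarith [hx.1, hy.2], by linarith [hx.2, hy.1]⟩
      rw [← Real.exp_log (hF.deriv_pos x), ← Real.exp_log (hF.deriv_pos y), ← Real.exp_add,
        Real.exp_le_exp]
      nlinarith
    rw [Function.iterate_succ, deriv_comp _ (hF.iterate_differentiable n _) (hF.differentiable x),
      deriv_comp _ (hF.iterate_differentiable n _) (hF.differentiable y),
      Finset.sum_range_succ']
    simp only [Function.iterate_succ, Function.comp_apply, Function.iterate_zero, id]
    rw [mul_add, Real.exp_add]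
    calc _ ≤ _ := mul_le_mul h1 h2 (hF.deriv_pos x).le
          (mul_nonneg (Real.exp_pos _).le (hF.deriv_iterate_pos n _).le)
      _ = _ := by ring

end NormalizedLift

/-- Finitely many intervals which are pairwise disjoint modulo `1` have total length at most `1`. -/
lemma sum_length_le_one (N : ℕ) (c d : ℕ → ℝ) (hcd : ∀ i < N, c i ≤ d i)
    (h : ∀ i < N, ∀ j < N, ∀ (e : ℤ) (z : ℝ), z ∈ Ioo (c i) (d i) → z + e ∈ Ioo (c j) (d j) →
      i = j ∧ e = 0) :
    ∑ i ∈ Finset.range N, (d i - c i) ≤ 1 := by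
  set s : Set ℝ := ⋃ i ∈ Finset.range N, Ioo (c i) (d i) with hs
  have hvol : volume s = ENNReal.ofReal (∑ i ∈ Finset.range N, (d i - c i)) := by
    rw [hs, measure_biUnion_finset, ENNReal.ofReal_sum_of_nonneg]
    · simp
    · intro i hi
      have := hcd i (Finset.mem_range.1 hi)
      linarith
    · intro i hi j hj hij
      simp only [Finset.coe_range, mem_Iio] at hi hj
      refine Set.disjoint_left.2 fun z hz hz' => hij ?_
      exact (h i hi j hj 0 z hz (by simpa using hz')).1
    · intro i _; exact measurableSet_Ioo
  by_contra hcon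
  push Not at hcon
  have hmeas : MeasurableSet s :=
    Finset.measurableSet_biUnion _ fun i _ => measurableSet_Ioo
  obtain ⟨x, y, hxy, hnd⟩ := exists_pair_mem_lattice_not_disjoint_vadd
    (isAddFundamentalDomain_Ioc (T := 1) one_pos 0) hmeas.nullMeasurableSet
    (show volume (Ioc (0 : ℝ) (0 + 1)) < volume s by
      rw [hvol, Real.volume_Ioc]
      exact (ENNReal.ofReal_lt_ofReal_iff (by linarith)).2 (by linarith))
  obtain ⟨w, hw1, hw2⟩ := Set.not_disjoint_iff.1 hnd
  obtain ⟨z1, hz1, rfl⟩ := Set.mem_vadd_set.1 hw1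
  obtain ⟨z2, hz2, h12⟩ := Set.mem_vadd_set.1 hw2
  obtain ⟨⟨x, hx⟩, ⟨y, hy⟩⟩ := And.intro x.2 y.2
  simp only [hs, Finset.mem_range, mem_iUnion, exists_prop] at hz1 hz2
  obtain ⟨i, hi, hz1⟩ := hz1
  obtain ⟨j, hj, hz2⟩ := hz2
  simp only [AddSubgroup.vadd_def, vadd_eq_add] at h12
  rw [← hx, ← hy] at h12
  simp only [zsmul_eq_mul, mul_one] at h12 hx hy
  have := (h i hi j hj (x - y) z1 hz1 (by
    have : z1 + ((x - y : ℤ) : ℝ) = z2 := by push_cast; linarith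
    rwa [this])).2
  apply hxy
  ext
  rw [← hx, ← hy, show x = y by omega]

/-- The set `B` occupies a proportion at most `ε` of the interval `{z | ⌊F^[k] z⌋ = J}`. -/
def SparseIn (F : ℝ → ℝ) (B : Set ℝ) (ε : ℝ) (k : ℕ) (J : ℤ) : Prop :=
  ∀ t r : ℝ, F^[k] t = J → F^[k] r = J + 1 → volume.real (B ∩ Ico t r) ≤ ε * (r - t)

namespace NormalizedLift

variable {F : ℝ → ℝ}

lemma mem_Ico_iff (hF : NormalizedLift F) {k : ℕ} {J : ℤ} {t r : ℝ} (ht : F^[k] t = J)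
    (hr : F^[k] r = J + 1) (z : ℝ) : z ∈ Ico t r ↔ ⌊F^[k] z⌋ = J := by
  rw [Int.floor_eq_iff, ← hr, ← ht, (hF.iterate_strictMono k).le_iff_le,
    (hF.iterate_strictMono k).lt_iff_lt, mem_Ico]

/-- Densities are transported by iterates of `F` with controlled distortion. -/
lemma volume_inter_Ico_iterate_le (hF : NormalizedLift F) {L : ℝ} (hL0 : 0 ≤ L)
    (hL : ∀ x y, Real.log (deriv F x) ≤ L * |x - y| + Real.log (deriv F y))
    (n : ℕ) {t r S ε : ℝ} (htr : t ≤ r) {B C : Set ℝ} (hB : MeasurableSet B)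
    (hBC : ∀ z ∈ Ico t r, F^[n] z ∈ C → z ∈ B)
    (hS : ∑ i ∈ Finset.range n, (F^[i] r - F^[i] t) ≤ S)
    (hε : volume.real (B ∩ Ico t r) ≤ ε * (r - t)) :
    volume.real (C ∩ Ico (F^[n] t) (F^[n] r)) ≤ Real.exp (L * S) * ε * (F^[n] r - F^[n] t) := by
  rcases htr.eq_or_lt with rfl | htr
  · simp
  obtain ⟨ξ, hξ, hslope⟩ := exists_deriv_eq_slope F^[n] htr
    (hF.iterate_continuous n).continuousOn (hF.iterate_differentiable n).differentiableOn
  have hrt : 0 < r - t := sub_pos.2 htr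
  rw [eq_div_iff hrt.ne'] at hslope
  set M := Real.exp (L * S) * deriv F^[n] ξ with hM
  have hM0 : 0 ≤ M := mul_nonneg (Real.exp_pos _).le (hF.deriv_iterate_pos n ξ).le
  have hbound : ∀ z ∈ Icc t r, deriv F^[n] z ≤ M := fun z hz =>
    (hF.deriv_iterate_le hL0 hL n hz (Ioo_subset_Icc_self hξ)).trans
      (mul_le_mul_of_nonneg_right (Real.exp_le_exp.2 (mul_le_mul_of_nonneg_left hS hL0))
        (hF.deriv_iterate_pos n ξ).le)
  have hmeas : MeasurableSet (B ∩ Ico t r) := hB.inter measurableSet_Ico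
  have hfin : volume (B ∩ Ico t r) ≠ ⊤ :=
    measure_ne_top_of_subset inter_subset_right (by simp)
  have hsub : C ∩ Ico (F^[n] t) (F^[n] r) ⊆ F^[n] '' (B ∩ Ico t r) := by
    rintro y ⟨hyC, hy⟩
    obtain ⟨z, rfl⟩ := hF.iterate_surjective n y
    have hz : z ∈ Ico t r := ⟨(hF.iterate_strictMono n).le_iff_le.1 hy.1,
      (hF.iterate_strictMono n).lt_iff_lt.1 hy.2⟩
    exact ⟨z, ⟨hBC z hz hyC, hz⟩, rfl⟩
  have himg : volume (F^[n] '' (B ∩ Ico t r)) ≤ ENNReal.ofReal M * volume (B ∩ Ico t r) := by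
    have := lintegral_image_eq_lintegral_abs_deriv_mul hmeas
      (fun x _ => ((hF.iterate_differentiable n x).hasDerivAt).hasDerivWithinAt)
      (hF.iterate_strictMono n).injective.injOn (fun _ => 1)
    simp only [lintegral_const, one_mul, mul_one, MeasurableSet.univ, Measure.restrict_apply,
      univ_inter] at this
    rw [this, ← setLIntegral_const]
    refine setLIntegral_mono measurable_const fun x hx => ENNReal.ofReal_le_ofReal ?_
    rw [abs_of_pos (hF.deriv_iterate_pos n x)]
    exact hbound x (Ico_subset_Icc_self hx.2)
  have h1 : volume.real (C ∩ Ico (F^[n] t) (F^[n] r)) ≤ M * volume.real (B ∩ Ico t r) := by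
    have h2 := ENNReal.toReal_mono (ENNReal.mul_ne_top ENNReal.ofReal_ne_top hfin)
      ((measure_mono hsub).trans himg)
    rwa [ENNReal.toReal_mul, ENNReal.toReal_ofReal hM0] at h2
  calc _ ≤ M * (ε * (r - t)) := h1.trans (mul_le_mul_of_nonneg_left hε hM0)
    _ = _ := by rw [← hslope, hM]; ring

lemma sparseIn_add (hF : NormalizedLift F) {B : Set ℝ} (hB : ∀ (x : ℝ) (m : ℤ), x + m ∈ B ↔ x ∈ B)
    {ε : ℝ} {k : ℕ} {J J' : ℤ} (h : SparseIn F B ε k J) (hJ : J' ≡ J [ZMOD 2 ^ k]) :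
    SparseIn F B ε k J' := by
  obtain ⟨m, hm⟩ := hJ.dvd
  intro t r ht hr
  have key := h (t + m) (r + m) (by rw [hF.iterate_add_int, ht, ← hm]; push_cast; ring)
    (by rw [hF.iterate_add_int, hr, ← hm]; push_cast; ring)
  have : B ∩ Ico (t + m) (r + m) = (fun x => x + (-m : ℝ)) ⁻¹' (B ∩ Ico t r) := by
    ext x
    have := hB (x + -m) m
    simp only [neg_add_cancel_right] at this
    simp only [mem_inter_iff, mem_preimage, mem_Ico, this]
    refine and_congr_right fun _ => ?_
    constructor <;> rintro ⟨h1, h2⟩ <;> constructor <;> linarith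
  rw [this, measureReal_def, measure_preimage_add_right, ← measureReal_def] at key
  linarith

/-- Along a first entry into a cell, densities are transported with uniformly bounded distortion. -/
lemma sparseIn_of_first_entry (hF : NormalizedLift F) {L : ℝ} (hL0 : 0 ≤ L)
    (hL : ∀ x y, Real.log (deriv F x) ≤ L * |x - y| + Real.log (deriv F y))
    {B : Set ℝ} (hB : MeasurableSet B) (hFB : ∀ z, F z ∈ B → z ∈ B) {k n : ℕ} {x ε : ℝ}
    (hn : ∀ i < n, ¬ ⌊F^[k] (F^[i] x)⌋ ≡ ⌊F^[k] (F^[n] x)⌋ [ZMOD 2 ^ k])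
    (h : SparseIn F B ε (k + n) ⌊F^[k + n] x⌋) :
    SparseIn F B (Real.exp L * ε) k ⌊F^[k] (F^[n] x)⌋ := by
  intro u v hu hv
  obtain ⟨t, rfl⟩ := hF.iterate_surjective n u
  obtain ⟨r, rfl⟩ := hF.iterate_surjective n v
  rw [← Function.iterate_add_apply] at hu hv hn
  rw [← Function.iterate_add_apply] at hu hv
  set J := ⌊F^[k + n] x⌋ with hJ
  have htr : t < r := (hF.iterate_strictMono (k + n)).lt_iff_lt.1 (by rw [hu, hv]; linarith)
  have hFB' : ∀ (j : ℕ) z, F^[j] z ∈ B → z ∈ B := by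
    intro j
    induction j with
    | zero => simp
    | succ j ih => intro z hz; exact hFB z (ih _ hz)
  have hS : ∑ i ∈ Finset.range n, (F^[i] r - F^[i] t) ≤ 1 := by
    apply sum_length_le_one n (fun i => F^[i] t) (fun i => F^[i] r)
    · intro i _; exact (hF.iterate_strictMono i).monotone htr.le
    have key : ∀ i < n, ∀ z ∈ Ioo (F^[i] t) (F^[i] r), ⌊F^[k + n - i] z⌋ = J := by
      intro i hi z hz
      refine (hF.mem_Ico_iff ?_ ?_ z).1 (Ioo_subset_Ico_self hz)
      · rw [← Function.iterate_add_apply, show k + n - i + i = k + n by omega, hu]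
      · rw [← Function.iterate_add_apply, show k + n - i + i = k + n by omega, hv]
    have main : ∀ i j, i ≤ j → j < n → ∀ (e : ℤ) (z : ℝ), z ∈ Ioo (F^[i] t) (F^[i] r) →
        z + e ∈ Ioo (F^[j] t) (F^[j] r) → i = j ∧ e = 0 := by
      intro i j hij hj e z hz hz'
      have h1 := key i (by omega) z hz
      have h2 := key j hj _ hz'
      rw [hF.floor_iterate_add_int, hF.floor_eq_floor_iterate_ediv (j - i),
        ← Function.iterate_add_apply, show j - i + (k + n - j) = k + n - i by omega, h1, hJ,
        show k + n = (j - i) + (k + n - (j - i)) by omega, Function.iterate_add_apply,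
        ← hF.floor_eq_floor_iterate_ediv, ← Function.iterate_add_apply,
        show j - i + (k + n - (j - i)) = k + n by omega, ← hJ] at h2
      have hij' : i = j := by
        by_contra hne
        apply hn (n - (j - i)) (by omega)
        rw [← Function.iterate_add_apply, show k + (n - (j - i)) = k + n - (j - i) by omega, ← h2]
        apply Int.ModEq.symm
        apply (Int.modEq_iff_dvd).2
        rw [show k + n - j = k + (n - j) by omega, pow_add]
        exact ⟨-(2 ^ (n - j) * e), by ring⟩
      refine ⟨hij', ?_⟩
      subst hij'
      simpa [← hJ] using h2
    intro i hi j hj e z hz hz'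
    rcases le_total i j with hij | hij
    · exact main i j hij hj e z hz hz'
    · have := main j i hij hi (-e) (z + e) hz' (by simpa using hz)
      exact ⟨this.1.symm, by simpa using this.2⟩
  have := hF.volume_inter_Ico_iterate_le hL0 hL n htr.le hB
    (fun z _ hz => hFB' n z hz) hS (h t r hu hv)
  rwa [mul_one] at this

/-- At a density point, the complement `B` has small density in all small cells visited by the
orbit. -/
lemma sparseIn_of_visit (hF : NormalizedLift F)
    {B : Set ℝ} (hB : MeasurableSet B) (hBp : ∀ (x : ℝ) (m : ℤ), x + m ∈ B ↔ x ∈ B)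
    (hFB : ∀ z, F z ∈ B → z ∈ B) {x : ℝ}
    (hx : ∀ ε > 0, ∃ k₀, ∀ k ≥ k₀, SparseIn F B ε k ⌊F^[k] x⌋) :
    ∀ ε > 0, ∃ k₀, ∀ k ≥ k₀, ∀ (n : ℕ) (J : ℤ), ⌊F^[k] (F^[n] x)⌋ ≡ J [ZMOD 2 ^ k] →
      SparseIn F B ε k J := by
  obtain ⟨L, hL0, hL⟩ := hF.exists_lipschitz_log_deriv
  intro ε hε
  obtain ⟨k₀, hk₀⟩ := hx (Real.exp (-L) * ε) (by positivity)
  refine ⟨k₀, fun k hk n J hJ => ?_⟩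
  classical
  have hex : ∃ n, ⌊F^[k] (F^[n] x)⌋ ≡ J [ZMOD 2 ^ k] := ⟨n, hJ⟩
  have h1 := Nat.find_spec hex
  have h2 := hF.sparseIn_of_first_entry hL0 hL hB hFB (k := k) (n := Nat.find hex) (x := x)
    (fun i hi hcon => Nat.find_min hex hi (hcon.trans h1)) (hk₀ _ (by omega))
  rw [← mul_assoc, ← Real.exp_add, add_neg_cancel, Real.exp_zero, one_mul] at h2
  exact hF.sparseIn_add hBp h2 h1.symm

/-- If `B` is not null in a cell, then the orbit of a density point of the complement of `B`
visits this cell either never again or within a bounded time. -/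
lemma exists_first_entry_le (hF : NormalizedLift F)
    {B : Set ℝ} (hB : MeasurableSet B) (hBp : ∀ (x : ℝ) (m : ℤ), x + m ∈ B ↔ x ∈ B)
    (hFB : ∀ z, F z ∈ B → z ∈ B) {x : ℝ}
    (hx : ∀ ε > 0, ∃ k₀, ∀ k ≥ k₀, SparseIn F B ε k ⌊F^[k] x⌋)
    {k : ℕ} {J : ℤ} {ε : ℝ} (hε : 0 < ε) (hJ : ¬ SparseIn F B ε k J) :
    ∃ N : ℕ, ∀ m n : ℕ, (∀ i < n, ¬ ⌊F^[k] (F^[i] (F^[m] x))⌋ ≡ J [ZMOD 2 ^ k]) →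
      ⌊F^[k] (F^[n] (F^[m] x))⌋ ≡ J [ZMOD 2 ^ k] → n ≤ N := by
  obtain ⟨L, hL0, hL⟩ := hF.exists_lipschitz_log_deriv
  obtain ⟨N, hN⟩ := hF.sparseIn_of_visit hB hBp hFB hx (Real.exp (-L) * ε) (by positivity)
  refine ⟨N, fun m n hmn hn => ?_⟩
  by_contra hlt
  apply hJ
  have h2 := hF.sparseIn_of_first_entry hL0 hL hB hFB (k := k) (n := n) (x := F^[m] x)
    (fun i hi hcon => hmn i hi (hcon.trans hn)) (hN _ (by omega) m _ rfl)
  rw [← mul_assoc, ← Real.exp_add, add_neg_cancel, Real.exp_zero, one_mul] at h2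
  exact hF.sparseIn_add hBp h2 hn.symm

end NormalizedLift

lemma unitAddCircle_coe_eq_coe_iff {a b : ℝ} :
    (a : UnitAddCircle) = b ↔ ∃ m : ℤ, b = a + m := by
  rw [QuotientAddGroup.eq, AddSubgroup.mem_zmultiples_iff]
  refine exists_congr fun m => ?_
  rw [zsmul_eq_mul, mul_one]
  constructor <;> intro h <;> linarith

lemma iterate_coe {φ : UnitAddCircle → UnitAddCircle} {F : ℝ → ℝ}
    (hφ : ∀ x : ℝ, φ x = (F x : ℝ)) (n : ℕ) (x : ℝ) : φ^[n] x = (F^[n] x : ℝ) := by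
  induction n generalizing x with
  | zero => rfl
  | succ n ih => rw [Function.iterate_succ_apply, hφ, ih, Function.iterate_succ_apply]

lemma conj_iterate {φ : UnitAddCircle → UnitAddCircle} {h : UnitAddCircle → UnitAddCircle}
    (hh : ∀ x, h (φ x) = doubling (h x)) (n : ℕ) (x : UnitAddCircle) :
    h (φ^[n] x) = (2 ^ n : ℕ) • h x := by
  induction n generalizing x with
  | zero => simp
  | succ n ih =>
    rw [Function.iterate_succ_apply, ih, hh, doubling, ← two_nsmul, ← mul_nsmul', pow_succ]

lemma continuous_of_lift {φ : UnitAddCircle → UnitAddCircle} {F : ℝ → ℝ} (hF : Continuous F)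
    (hφ : ∀ x : ℝ, φ x = (F x : ℝ)) : Continuous φ := by
  have hq : IsQuotientMap ((↑) : ℝ → UnitAddCircle) := isQuotientMap_quotient_mk'
  rw [hq.continuous_iff]
  have : φ ∘ ((↑) : ℝ → UnitAddCircle) = fun x => ((F x : ℝ) : UnitAddCircle) := funext hφ
  rw [this]
  exact (AddCircle.continuous_mk' 1).comp hF

lemma isOpen_coe_image {s : Set ℝ} (hs : IsOpen s) :
    IsOpen ((fun t : ℝ => (t : UnitAddCircle)) '' s) :=
  QuotientAddGroup.isOpenMap_coe s hs

/-- The points whose orbit under `φ` is finite. -/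
def eventuallyPeriodicPts (φ : UnitAddCircle → UnitAddCircle) : Set UnitAddCircle :=
  {x | ∃ m p : ℕ, 1 ≤ p ∧ φ^[p] (φ^[m] x) = φ^[m] x}

lemma countable_eventuallyPeriodicPts {φ : UnitAddCircle → UnitAddCircle}
    (h : UnitAddCircle ≃ₜ UnitAddCircle) (hh : ∀ x, h (φ x) = doubling (h x)) :
    (eventuallyPeriodicPts φ).Countable := by
  have hsub : eventuallyPeriodicPts φ ⊆
      h ⁻¹' ⋃ q : ℕ, {u : UnitAddCircle | (q + 1) • u = 0} := by
    rintro x ⟨m, p, hp, hx⟩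
    have h1 := congrArg h hx
    rw [← Function.iterate_add_apply, conj_iterate hh, conj_iterate hh] at h1
    have hlt : 2 ^ m < 2 ^ (p + m) := Nat.pow_lt_pow_right (by norm_num) (by omega)
    refine mem_iUnion.2 ⟨2 ^ (p + m) - 2 ^ m - 1, ?_⟩
    show (2 ^ (p + m) - 2 ^ m - 1 + 1) • h x = 0
    rw [show 2 ^ (p + m) - 2 ^ m - 1 + 1 = 2 ^ (p + m) - 2 ^ m by omega, sub_nsmul _ hlt.le, h1]
    simp
  refine Countable.mono hsub (Countable.preimage_of_injOn ?_ h.injective.injOn)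
  exact countable_iUnion fun q => (AddCircle.finite_torsion 1 (Nat.succ_pos q)).countable

lemma countable_coe_preimage {s : Set UnitAddCircle} (hs : s.Countable) :
    ((fun t : ℝ => (t : UnitAddCircle)) ⁻¹' s).Countable := by
  rw [← biUnion_preimage_singleton]
  refine hs.biUnion fun y _ => ?_
  obtain ⟨a, rfl⟩ := QuotientAddGroup.mk_surjective y
  refine (countable_range fun m : ℤ => a + m).mono ?_
  intro b hb
  obtain ⟨m, hm⟩ := unitAddCircle_coe_eq_coe_iff.1 (show (a : UnitAddCircle) = b from hb.symm)
  exact ⟨m, hm.symm⟩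

namespace NormalizedLift

variable {F : ℝ → ℝ}

lemma exists_one_lt_iterate_sub (hF : NormalizedLift F) {φ : UnitAddCircle → UnitAddCircle}
    (hφ : ∀ x : ℝ, φ x = (F x : ℝ)) (h : UnitAddCircle ≃ₜ UnitAddCircle)
    (hh : ∀ x, h (φ x) = doubling (h x)) (z : ℝ) {δ : ℝ} (hδ : 0 < δ) :
    ∃ k, 1 < F^[k] (z + δ) - F^[k] z := by
  set O : Set UnitAddCircle := h '' ((fun t : ℝ => (t : UnitAddCircle)) '' Ioo z (z + δ)) with hO
  have hOo : IsOpen O := h.isOpenMap _ (isOpen_coe_image isOpen_Ioo)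
  have hv : h ((z + δ / 2 : ℝ) : UnitAddCircle) ∈ O :=
    mem_image_of_mem _ (mem_image_of_mem _ ⟨by linarith, by linarith⟩)
  set v := h ((z + δ / 2 : ℝ) : UnitAddCircle)
  have hlim : Tendsto (fun k : ℕ => v + (((1 / 2 : ℝ) ^ k : ℝ) : UnitAddCircle)) atTop (𝓝 v) := by
    have h1 := tendsto_pow_atTop_nhds_zero_of_lt_one (r := (1 / 2 : ℝ)) (by norm_num) (by norm_num)
    have h2 := ((AddCircle.continuous_mk' (1 : ℝ)).tendsto 0).comp h1
    have h3 := tendsto_const_nhds (x := v).add h2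
    simpa using h3
  obtain ⟨k, hk, hk1⟩ := ((hlim.eventually (hOo.mem_nhds hv)).and (eventually_ge_atTop 1)).exists
  obtain ⟨_, ⟨t2, ht2, rfl⟩, hv2⟩ := hk
  refine ⟨k, ?_⟩
  have hpow : (2 ^ k : ℕ) • (((1 / 2 : ℝ) ^ k : ℝ) : UnitAddCircle) = 0 := by
    rw [← AddCircle.coe_nsmul, nsmul_eq_mul]
    push_cast
    rw [← mul_pow]
    norm_num
  have heq : φ^[k] (t2 : UnitAddCircle) = φ^[k] ((z + δ / 2 : ℝ) : UnitAddCircle) := by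
    apply h.injective
    rw [conj_iterate hh, conj_iterate hh, hv2, nsmul_add, hpow, add_zero]
  rw [iterate_coe hφ, iterate_coe hφ, unitAddCircle_coe_eq_coe_iff] at heq
  obtain ⟨m, hm⟩ := heq
  have hne : m ≠ 0 := by
    rintro rfl
    have := (hF.iterate_strictMono k).injective (by simpa using hm)
    rw [← this] at hv2
    have h0 : (((1 / 2 : ℝ) ^ k : ℝ) : UnitAddCircle) = ((0 : ℝ) : UnitAddCircle) := by
      rw [AddCircle.coe_zero]
      exact (left_eq_add.1 hv2)
    obtain ⟨j, hj⟩ := unitAddCircle_coe_eq_coe_iff.1 h0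
    have hp : (0 : ℝ) < (1 / 2) ^ k := by positivity
    have hp1 : (1 / 2 : ℝ) ^ k < 1 := pow_lt_one₀ (by norm_num) (by norm_num) (by omega)
    have e1 : (-1 : ℤ) < j := by exact_mod_cast (show (-1 : ℝ) < j by linarith)
    have e2 : j < 0 := by exact_mod_cast (show (j : ℝ) < 0 by linarith)
    omega
  have e1 := hF.iterate_strictMono k ht2.1
  have e2 := hF.iterate_strictMono k ht2.2
  have e3 := hF.iterate_strictMono k (show z < z + δ / 2 by linarith)
  have e4 := hF.iterate_strictMono k (show z + δ / 2 < z + δ by linarith)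
  rcases lt_or_gt_of_ne hne with hneg | hpos
  · have : (m : ℝ) ≤ -1 := by exact_mod_cast (show m ≤ -1 by omega)
    linarith
  · have : (1 : ℝ) ≤ m := by exact_mod_cast (show 1 ≤ m by omega)
    linarith

lemma one_lt_iterate_sub_mono (hF : NormalizedLift F) {k l : ℕ} (hkl : k ≤ l) {z w : ℝ}
    (h : 1 < F^[k] w - F^[k] z) : 1 < F^[l] w - F^[l] z := by
  induction l, hkl using Nat.le_induction with
  | base => exact h
  | succ l _ ih =>
    rw [Function.iterate_succ_apply', Function.iterate_succ_apply']
    have h1 := hF.strictMono (show F^[l] z + 1 < F^[l] w by linarith)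
    rw [hF.map_add_one] at h1
    linarith

/-- The cells of large degree are uniformly small. -/
lemma exists_forall_one_lt_iterate_sub (hF : NormalizedLift F) {φ : UnitAddCircle → UnitAddCircle}
    (hφ : ∀ x : ℝ, φ x = (F x : ℝ)) (h : UnitAddCircle ≃ₜ UnitAddCircle)
    (hh : ∀ x, h (φ x) = doubling (h x)) {δ : ℝ} (hδ : 0 < δ) :
    ∃ k, ∀ l ≥ k, ∀ z, 1 < F^[l] (z + δ) - F^[l] z := by
  obtain ⟨k, hk⟩ := (isCompact_Icc (a := (0 : ℝ)) (b := 1)).elim_directed_cover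
    (fun k : ℕ => {z : ℝ | 1 < F^[k] (z + δ) - F^[k] z})
    (fun k => isOpen_lt continuous_const (((hF.iterate_continuous k).comp
      (continuous_id.add continuous_const)).sub (hF.iterate_continuous k)))
    (fun z _ => mem_iUnion.2 (hF.exists_one_lt_iterate_sub hφ h hh z hδ))
    (directed_of_isDirected_le fun k l hkl z hz => hF.one_lt_iterate_sub_mono hkl hz)
  refine ⟨k, fun l hl z => hF.one_lt_iterate_sub_mono hl ?_⟩
  have h1 : Int.fract z ∈ Icc (0 : ℝ) 1 := ⟨Int.fract_nonneg z, (Int.fract_lt_one z).le⟩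
  have h2 : 1 < F^[k] (Int.fract z + δ) - F^[k] (Int.fract z) := hk h1
  have h3 := hF.iterate_add_int k (Int.fract z) ⌊z⌋
  have h4 := hF.iterate_add_int k (Int.fract z + δ) ⌊z⌋
  rw [Int.fract_add_floor] at h3
  rw [add_right_comm, Int.fract_add_floor] at h4
  linarith

lemma sub_lt_of_iterate_sub_le {k : ℕ} {δ : ℝ} (hF : NormalizedLift F)
    (hk : ∀ z, 1 < F^[k] (z + δ) - F^[k] z) {t r : ℝ} (h : F^[k] r - F^[k] t ≤ 1) :
    r - t < δ := by
  by_contra hcon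
  have h1 := (hF.iterate_strictMono k).monotone (show t + δ ≤ r by linarith)
  have := hk t
  linarith

/-- Almost every point of `A` is a density point of `A` with respect to the cells. -/
lemma ae_sparseIn_compl (hF : NormalizedLift F)
    (hmesh : ∀ δ > 0, ∃ k, ∀ l ≥ k, ∀ z, 1 < F^[l] (z + δ) - F^[l] z)
    {A : Set ℝ} (hA : MeasurableSet A) :
    ∀ᵐ x, x ∈ A → ∀ ε > 0, ∃ k₀, ∀ k ≥ k₀, SparseIn F Aᶜ ε k ⌊F^[k] x⌋ := by
  rw [← ae_restrict_iff' hA]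
  filter_upwards [IsUnifLocDoublingMeasure.ae_tendsto_measure_inter_div volume A 1] with x hx ε hε
  choose t ht using fun k : ℕ => hF.iterate_surjective k (⌊F^[k] x⌋ : ℝ)
  choose r hr using fun k : ℕ => hF.iterate_surjective k (⌊F^[k] x⌋ + 1 : ℝ)
  have htr : ∀ k, t k < r k := fun k =>
    (hF.iterate_strictMono k).lt_iff_lt.1 (by rw [ht, hr]; linarith)
  have hxm : ∀ k, x ∈ Ico (t k) (r k) := fun k => (hF.mem_Ico_iff (ht k) (hr k) x).2 rfl
  have hball : ∀ k, Metric.closedBall ((t k + r k) / 2) ((r k - t k) / 2) = Icc (t k) (r k) := by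
    intro k; rw [Real.closedBall_eq_Icc]; congr 1 <;> ring
  have hlim : Tendsto (fun k => (r k - t k) / 2) atTop (𝓝[>] 0) := by
    rw [tendsto_nhdsWithin_iff]
    refine ⟨?_, Eventually.of_forall fun k => by simpa using htr k⟩
    rw [Metric.tendsto_atTop]
    intro δ hδ
    obtain ⟨k, hk⟩ := hmesh δ hδ
    refine ⟨k, fun l hl => ?_⟩
    have := hF.sub_lt_of_iterate_sub_le (hk l hl) (t := t l) (r := r l) (by rw [ht, hr]; linarith)
    have := htr l
    rw [Real.dist_eq, sub_zero, abs_of_pos (by linarith)]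
    linarith
  have key := hx (fun k => (t k + r k) / 2) (fun k => (r k - t k) / 2) hlim
    (Eventually.of_forall fun k => by
      rw [one_mul, hball]; exact Ico_subset_Icc_self (hxm k))
  simp only [hball] at key
  have hev := key.eventually (lt_mem_nhds (a := ENNReal.ofReal (1 - ε)) (b := 1) (by
    rw [ENNReal.ofReal_lt_one]; linarith))
  obtain ⟨k₀, hk₀⟩ := eventually_atTop.1 hev
  refine ⟨k₀, fun k hk t' r' ht' hr' => ?_⟩
  obtain rfl : t' = t k := (hF.iterate_strictMono k).injective (by rw [ht', ht])
  obtain rfl : r' = r k := (hF.iterate_strictMono k).injective (by rw [hr', hr])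
  have h1 := hk₀ k hk
  have hpos : 0 < r k - t k := sub_pos.2 (htr k)
  have hfin : volume (A ∩ Icc (t k) (r k)) ≠ ⊤ :=
    measure_ne_top_of_subset inter_subset_right (by simp)
  rw [Real.volume_Icc, ENNReal.lt_div_iff_mul_lt (by simp [htr k]) (by simp)] at h1
  have h2 : (1 - ε) * (r k - t k) ≤ volume.real (A ∩ Ico (t k) (r k)) := by
    have h3 : volume (A ∩ Icc (t k) (r k)) = volume (A ∩ Ico (t k) (r k)) :=
      measure_congr ((ae_eq_refl A).inter Ico_ae_eq_Icc.symm)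
    rw [h3] at h1 hfin
    rcases le_or_gt (1 - ε) 0 with hneg | hp
    · exact (mul_nonpos_of_nonpos_of_nonneg hneg hpos.le).trans measureReal_nonneg
    · rw [← ENNReal.ofReal_mul hp.le] at h1
      exact (ENNReal.ofReal_le_iff_le_toReal hfin).1 h1.le
  have h4 : volume.real (A ∩ Ico (t k) (r k)) + volume.real (Aᶜ ∩ Ico (t k) (r k)) = r k - t k := by
    have := measureReal_inter_add_sdiff (μ := volume) (s := Ico (t k) (r k)) hA (by simp)
    rw [Real.volume_real_Ico_of_le (htr k).le] at this
    rw [← this, inter_comm A, sdiff_eq, inter_comm Aᶜ]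
  linarith

end NormalizedLift

/-- The set of points whose forward orbit avoids the cells of degree `κ` congruent to `K`. -/
def avoidingSet (F : ℝ → ℝ) (κ : ℕ) (K : ℤ) : Set ℝ :=
  {x | ∀ n, ¬ ⌊F^[κ] (F^[n] x)⌋ ≡ K [ZMOD 2 ^ κ]}

namespace NormalizedLift

variable {F : ℝ → ℝ}

lemma measurableSet_avoidingSet (hF : NormalizedLift F) (κ : ℕ) (K : ℤ) :
    MeasurableSet (avoidingSet F κ K) := by
  have : avoidingSet F κ K =
      ⋂ n : ℕ, (fun x => ⌊F^[κ] (F^[n] x)⌋) ⁻¹' {j | ¬ j ≡ K [ZMOD 2 ^ κ]} := by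
    ext x; simp [avoidingSet]
  rw [this]
  refine MeasurableSet.iInter fun n => ?_
  exact (Int.measurable_floor.comp ((hF.iterate_continuous κ).comp
    (hF.iterate_continuous n)).measurable) (MeasurableSet.of_discrete)

lemma add_int_mem_avoidingSet_iff (hF : NormalizedLift F) (κ : ℕ) (K : ℤ) (x : ℝ) (m : ℤ) :
    x + m ∈ avoidingSet F κ K ↔ x ∈ avoidingSet F κ K := by
  refine forall_congr' fun n => not_congr ?_
  rw [hF.iterate_add_int, hF.floor_iterate_add_int]
  simp [Int.ModEq]

lemma map_mem_avoidingSet {κ : ℕ} {K : ℤ} {x : ℝ} (hx : x ∈ avoidingSet F κ K) :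
    F x ∈ avoidingSet F κ K := fun n => hx (n + 1)

/-- Every cell contains a definite proportion of points entering a given cell. -/
lemma exists_not_sparseIn_compl_avoidingSet (hF : NormalizedLift F) (κ : ℕ) (K : ℤ)
    (k : ℕ) (J : ℤ) : ∃ ε > 0, ¬ SparseIn F (avoidingSet F κ K)ᶜ ε k J := by
  obtain ⟨t, ht⟩ := hF.iterate_surjective k J
  obtain ⟨r, hr⟩ := hF.iterate_surjective k (J + 1)
  have hp : (0 : ℤ) < 2 ^ κ := by positivity
  set K' : ℤ := 2 ^ κ * J + K % 2 ^ κ with hK'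
  have hm0 := Int.emod_nonneg K hp.ne'
  have hm1 := Int.emod_lt_of_pos K hp
  obtain ⟨u, hu⟩ := hF.iterate_surjective (κ + k) K'
  obtain ⟨v, hv⟩ := hF.iterate_surjective (κ + k) (K' + 1)
  have htr : t < r := (hF.iterate_strictMono k).lt_iff_lt.1 (by rw [ht, hr]; linarith)
  have huv : u < v := (hF.iterate_strictMono (κ + k)).lt_iff_lt.1 (by rw [hu, hv]; linarith)
  have htu : t ≤ u := by
    rw [← (hF.iterate_strictMono (κ + k)).le_iff_le, Function.iterate_add_apply, ht,
      hF.iterate_int, hu]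
    exact_mod_cast (by omega : 2 ^ κ * J ≤ K')
  have hvr : v ≤ r := by
    rw [← (hF.iterate_strictMono (κ + k)).le_iff_le, Function.iterate_add_apply _ _ _ r, hr, hv]
    have := hF.iterate_int κ (J + 1)
    push_cast at this
    rw [this]
    exact_mod_cast (by rw [mul_add]; omega : K' + 1 ≤ 2 ^ κ * (J + 1))
  have hsub : Ico u v ⊆ (avoidingSet F κ K)ᶜ ∩ Ico t r := by
    refine subset_inter ?_ (Ico_subset_Ico htu hvr)
    intro z hz hcon
    apply hcon k
    rw [← Function.iterate_add_apply, (hF.mem_Ico_iff hu hv z).1 hz, hK']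
    simp [Int.ModEq]
  have hle := measureReal_mono (μ := volume) hsub
    (measure_ne_top_of_subset inter_subset_right (by simp))
  rw [Real.volume_real_Ico_of_le huv.le] at hle
  refine ⟨(v - u) / (2 * (r - t)), div_pos (by linarith) (by linarith), fun hs => ?_⟩
  have h1 := hs t r ht hr
  have h2 : (v - u) / (2 * (r - t)) * (r - t) = (v - u) / 2 := by
    have : r - t ≠ 0 := by linarith
    field_simp
  linarith

end NormalizedLift

/-- The set of cluster points of the forward orbit of `x`. -/
def omegaLimitPts {X : Type*} [TopologicalSpace X] (φ : X → X) (x : X) : Set X :=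
  {y | MapClusterPt y atTop fun n => φ^[n] x}

section omegaLimitPts

variable {X : Type*} [TopologicalSpace X] {φ : X → X} {x y : X}

lemma isClosed_omegaLimitPts : IsClosed (omegaLimitPts φ x) := isClosed_setOfPred_clusterPt

lemma map_mem_omegaLimitPts (hφ : Continuous φ) (hy : y ∈ omegaLimitPts φ x) :
    φ y ∈ omegaLimitPts φ x := by
  have h1 : MapClusterPt (φ y) atTop (φ ∘ fun n => φ^[n] x) :=
    MapClusterPt.continuousAt_comp hφ.continuousAt hy
  have h2 : (φ ∘ fun n => φ^[n] x) = (fun n => φ^[n] x) ∘ fun n => n + 1 := by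
    ext n; simp [Function.iterate_succ_apply']
  rw [h2] at h1
  exact h1.of_comp (tendsto_add_atTop_nat 1)

lemma iterate_mem_omegaLimitPts (hφ : Continuous φ) (hy : y ∈ omegaLimitPts φ x) (n : ℕ) :
    φ^[n] y ∈ omegaLimitPts φ x := by
  induction n with
  | zero => exact hy
  | succ n ih => rw [Function.iterate_succ_apply']; exact map_mem_omegaLimitPts hφ ih

lemma exists_map_eq_of_mem_omegaLimitPts [CompactSpace X] [T2Space X] (hφ : Continuous φ)
    (hy : y ∈ omegaLimitPts φ x) : ∃ z ∈ omegaLimitPts φ x, φ z = y := by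
  obtain ⟨U, hU, hlim⟩ := mapClusterPt_iff_ultrafilter.1 hy
  obtain ⟨z, -, hz⟩ := isCompact_univ.ultrafilter_le_nhds (U.map fun n => φ^[n - 1] x) (by simp)
  have hz' : Tendsto (fun n => φ^[n - 1] x) U (𝓝 z) := hz
  have hpred : Tendsto (fun n => n - 1) (U : Filter ℕ) atTop :=
      (tendsto_sub_atTop_nat 1).mono_left hU
  refine ⟨z, ?_, ?_⟩
  · refine mapClusterPt_iff_ultrafilter.2 ⟨U.map fun n => n - 1, hpred, ?_⟩
    rw [Ultrafilter.coe_map, tendsto_map'_iff]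
    exact hz'
  · have h1 : Tendsto (fun n => φ (φ^[n - 1] x)) U (𝓝 (φ z)) := (hφ.tendsto z).comp hz'
    refine tendsto_nhds_unique (h1.congr' ?_) hlim
    filter_upwards [hU (eventually_ge_atTop 1)] with n hn
    rw [← Function.iterate_succ_apply' φ, Nat.succ_eq_add_one, Nat.sub_add_cancel hn]

lemma exists_iterate_eq_of_mem_omegaLimitPts [CompactSpace X] [T2Space X] (hφ : Continuous φ)
    (hy : y ∈ omegaLimitPts φ x) (n : ℕ) : ∃ z ∈ omegaLimitPts φ x, φ^[n] z = y := by
  induction n with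
  | zero => exact ⟨y, hy, rfl⟩
  | succ n ih =>
    obtain ⟨w, hw, hwy⟩ := ih
    obtain ⟨z, hz, rfl⟩ := exists_map_eq_of_mem_omegaLimitPts hφ hw
    exact ⟨z, hz, hwy⟩

lemma omegaLimitPts_nonempty [CompactSpace X] : (omegaLimitPts φ x).Nonempty := by
  obtain ⟨y, -, hy⟩ := isCompact_univ.exists_mapClusterPt (f := atTop)
    (u := fun n => φ^[n] x) (by simp)
  exact ⟨y, hy⟩

end omegaLimitPts

lemma norm_two_nsmul_unitAddCircle {u : UnitAddCircle} (hu : ‖u‖ ≤ 1 / 4) :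
    ‖u + u‖ = 2 * ‖u‖ := by
  obtain ⟨a, rfl⟩ := QuotientAddGroup.mk_surjective u
  have h1 : ((a - round a : ℝ) : UnitAddCircle) = a :=
    unitAddCircle_coe_eq_coe_iff.2 ⟨round a, by ring⟩
  set b := a - round a
  change ‖(a : UnitAddCircle)‖ ≤ _ at hu
  change ‖(a : UnitAddCircle) + a‖ = 2 * ‖(a : UnitAddCircle)‖
  have h2 : ‖(a : UnitAddCircle)‖ = |b| := UnitAddCircle.norm_eq
  rw [h2] at hu ⊢
  rw [← h1, ← AddCircle.coe_add, ← two_mul, (AddCircle.norm_coe_eq_abs_iff 1 one_ne_zero).2]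
  · rw [abs_mul]; norm_num
  · rw [abs_mul]; norm_num; linarith

/-- An orbit whose cluster points lie in a finite invariant set is eventually periodic. -/
lemma mem_eventuallyPeriodicPts_of_finite {φ : UnitAddCircle → UnitAddCircle}
    (h : UnitAddCircle ≃ₜ UnitAddCircle) (hh : ∀ x, h (φ x) = doubling (h x))
    {P : Set UnitAddCircle} (hP : P.Finite) (hφP : ∀ a ∈ P, φ a ∈ P) {x : UnitAddCircle}
    (hx : omegaLimitPts φ x ⊆ P) : x ∈ eventuallyPeriodicPts φ := by
  suffices hN : ∃ N, φ^[N] x ∈ P by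
    obtain ⟨N, hN⟩ := hN
    have hmem : ∀ i, φ^[i] (φ^[N] x) ∈ P := fun i => by
      induction i with
      | zero => exact hN
      | succ i ih => rw [Function.iterate_succ_apply']; exact hφP _ ih
    obtain ⟨i, j, hij, heq⟩ := hP.exists_lt_map_eq_of_forall_mem hmem
    refine ⟨i + N, j - i, by omega, ?_⟩
    rw [← Function.iterate_add_apply, show j - i + (i + N) = j + N by omega,
      Function.iterate_add_apply, ← heq, Function.iterate_add_apply]
  obtain ⟨ε, hε, hε4, hsep⟩ : ∃ ε : ℝ, 0 < ε ∧ ε ≤ 1 / 4 ∧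
      ∀ a ∈ P, ∀ b ∈ P, ‖h a - h b‖ < 3 * ε → a = b := by
    obtain ⟨δ, hδ, hsep⟩ : ∃ δ > 0, ∀ a ∈ P, ∀ b ∈ P, ‖h a - h b‖ < δ → a = b := by
      have hfin := (hP.prod hP).subset (sep_subset (P ×ˢ P) fun q => q.1 ≠ q.2)
      have : ∀ᶠ δ in 𝓝[>] (0 : ℝ), ∀ q ∈ {q ∈ P ×ˢ P | q.1 ≠ q.2}, δ < ‖h q.1 - h q.2‖ := by
        rw [hfin.eventually_all]
        rintro q ⟨-, hq⟩
        exact nhdsWithin_le_nhds (gt_mem_nhds (norm_pos_iff.2 (sub_ne_zero.2 fun e =>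
          hq (h.injective e))))
      obtain ⟨δ, hδ, hδ0⟩ := (this.and self_mem_nhdsWithin).exists
      refine ⟨δ, hδ0, fun a ha b hb hab => by_contra fun hne => ?_⟩
      exact lt_asymm hab (hδ (a, b) ⟨⟨ha, hb⟩, hne⟩)
    refine ⟨min (δ / 3) (1 / 4), by positivity, min_le_right _ _, fun a ha b hb hab => ?_⟩
    refine hsep a ha b hb (hab.trans_le ?_)
    have := min_le_left (δ / 3) (1 / 4)
    linarith
  have hev : ∀ᶠ n in atTop, ∃ q ∈ P, ‖h (φ^[n] x) - h q‖ < ε := by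
    by_contra hcon
    rw [not_eventually] at hcon
    have hcl : IsClosed {u | ¬ ∃ q ∈ P, ‖h u - h q‖ < ε} := by
      have : {u | ¬ ∃ q ∈ P, ‖h u - h q‖ < ε} = ⋂ q ∈ P, {u | ε ≤ ‖h u - h q‖} := by
        ext u; simp
      rw [this]
      exact isClosed_biInter fun q _ =>
        isClosed_le continuous_const (h.continuous.sub continuous_const).norm
    obtain ⟨y, hy, hyc⟩ := hcl.isCompact.exists_mapClusterPt_of_frequently hcon
    exact hy ⟨y, hx hyc, by simpa using hε⟩
  obtain ⟨N, hN⟩ := eventually_atTop.1 hev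
  choose q hqP hq using fun i : ℕ => hN (N + i) (by omega)
  have hstep : ∀ i, φ (q i) = q (i + 1) ∧
      h (φ^[N + (i + 1)] x) - h (q (i + 1)) =
        (h (φ^[N + i] x) - h (q i)) + (h (φ^[N + i] x) - h (q i)) := by
    intro i
    have e1 : h (φ^[N + (i + 1)] x) = h (φ^[N + i] x) + h (φ^[N + i] x) := by
      rw [← add_assoc, Function.iterate_succ_apply', hh, doubling]
    have e2 : h (φ (q i)) = h (q i) + h (q i) := by rw [hh, doubling]
    have heq : φ (q i) = q (i + 1) := by
      apply hsep _ (hφP _ (hqP i)) _ (hqP (i + 1))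
      have h1 := hq (i + 1)
      have h2 := hq i
      calc ‖h (φ (q i)) - h (q (i + 1))‖
          = ‖(h (φ^[N + (i + 1)] x) - h (q (i + 1))) - (h (φ^[N + i] x) - h (q i))
            - (h (φ^[N + i] x) - h (q i))‖ := by rw [e1, e2]; congr 1; abel
        _ ≤ ‖h (φ^[N + (i + 1)] x) - h (q (i + 1))‖ + ‖h (φ^[N + i] x) - h (q i)‖
            + ‖h (φ^[N + i] x) - h (q i)‖ :=
          (norm_sub_le _ _).trans (by gcongr; exact norm_sub_le _ _)
        _ < 3 * ε := by linarith
    refine ⟨heq, ?_⟩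
    rw [← heq, e1, e2]; abel
  have hpow : ∀ i, ‖h (φ^[N + i] x) - h (q i)‖ = 2 ^ i * ‖h (φ^[N] x) - h (q 0)‖ := by
    intro i
    induction i with
    | zero => simp
    | succ i ih =>
      rw [(hstep i).2, norm_two_nsmul_unitAddCircle ((hq i).le.trans hε4), ih, pow_succ]; ring
  have hzero : ‖h (φ^[N] x) - h (q 0)‖ = 0 := by
    by_contra hne
    have hpos : 0 < ‖h (φ^[N] x) - h (q 0)‖ := lt_of_le_of_ne (norm_nonneg _) (Ne.symm hne)
    obtain ⟨i, hi⟩ := pow_unbounded_of_one_lt (ε / ‖h (φ^[N] x) - h (q 0)‖) one_lt_two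
    rw [div_lt_iff₀ hpos, ← hpow] at hi
    exact lt_asymm hi (hq i)
  refine ⟨N, ?_⟩
  rw [h.injective (sub_eq_zero.1 (norm_eq_zero.1 hzero))]
  exact hqP 0

namespace NormalizedLift

variable {F : ℝ → ℝ}

lemma dist_coe_lt_of_modEq (hF : NormalizedLift F) {k : ℕ} {δ : ℝ}
    (hk : ∀ z, 1 < F^[k] (z + δ) - F^[k] z) {z w : ℝ}
    (h : ⌊F^[k] z⌋ ≡ ⌊F^[k] w⌋ [ZMOD 2 ^ k]) :
    dist (z : UnitAddCircle) (w : UnitAddCircle) < δ := by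
  obtain ⟨m, hm⟩ := h.dvd
  have h1 : ((z + m : ℝ) : UnitAddCircle) = z := (unitAddCircle_coe_eq_coe_iff.2 ⟨m, rfl⟩).symm
  have h2 : ⌊F^[k] (z + m)⌋ = ⌊F^[k] w⌋ := by rw [hF.floor_iterate_add_int]; linarith
  have e1 := Int.floor_le (F^[k] (z + m))
  have e2 := Int.lt_floor_add_one (F^[k] (z + m))
  have e3 := Int.floor_le (F^[k] w)
  have e4 := Int.lt_floor_add_one (F^[k] w)
  rw [h2] at e1 e2
  have h3 := hF.sub_lt_of_iterate_sub_le hk (t := z + m) (r := w) (by linarith)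
  have h4 := hF.sub_lt_of_iterate_sub_le hk (t := w) (r := z + m) (by linarith)
  rw [← h1, dist_eq_norm, ← AddCircle.coe_sub]
  refine lt_of_le_of_lt ?_ (abs_lt.2 ⟨?_, h4⟩)
  · rw [UnitAddCircle.norm_eq]
    simpa using round_le (z + m - w) 0
  · linarith

/-- If the orbit of `x` enters each cell in bounded time, its limit set contains no periodic point
unless `x` itself is eventually periodic. -/
lemma iterate_ne_of_mem_omegaLimitPts (hF : NormalizedLift F)
    {φ : UnitAddCircle → UnitAddCircle} (hφ : ∀ x : ℝ, φ x = (F x : ℝ))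
    (h : UnitAddCircle ≃ₜ UnitAddCircle) (hh : ∀ x, h (φ x) = doubling (h x))
    (hmesh : ∀ δ > 0, ∃ k, ∀ l ≥ k, ∀ z, 1 < F^[l] (z + δ) - F^[l] z) {x : ℝ}
    (hgap : ∀ (k : ℕ) (J : ℤ), ∃ N : ℕ, ∀ m n : ℕ,
      (∀ i < n, ¬ ⌊F^[k] (F^[i] (F^[m] x))⌋ ≡ J [ZMOD 2 ^ k]) →
        ⌊F^[k] (F^[n] (F^[m] x))⌋ ≡ J [ZMOD 2 ^ k] → n ≤ N)
    (hx : (x : UnitAddCircle) ∉ eventuallyPeriodicPts φ) {a : UnitAddCircle}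
    (ha : a ∈ omegaLimitPts φ (x : UnitAddCircle)) {p : ℕ} (hp : 1 ≤ p) : φ^[p] a ≠ a := by
  intro hpa
  have hφc : Continuous φ := continuous_of_lift hF.continuous hφ
  set P : Set UnitAddCircle := range fun i : ℕ => φ^[i] a with hP
  have hPfin : P.Finite := by
    refine (finite_Iio p |>.image fun i : ℕ => φ^[i] a).subset ?_
    rintro _ ⟨i, rfl⟩
    refine ⟨i % p, Nat.mod_lt _ hp, ?_⟩
    have h1 : φ^[p * (i / p)] a = a := by
      rw [Function.iterate_mul]; exact Function.iterate_fixed hpa _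
    conv_rhs => rw [← Nat.mod_add_div i p]
    simp only [Function.iterate_add_apply, h1]
  refine hx (mem_eventuallyPeriodicPts_of_finite h hh hPfin ?_ ?_)
  · rintro _ ⟨i, rfl⟩
    exact ⟨i + 1, Function.iterate_succ_apply' φ i a⟩
  intro y hy
  by_contra hyP
  obtain ⟨δ, hδ, hball⟩ : ∃ δ > 0, Metric.closedBall y (2 * δ) ∩ P = ∅ := by
    obtain ⟨η, hη, hsub⟩ := Metric.isOpen_iff.1 hPfin.isClosed.isOpen_compl y hyP
    refine ⟨η / 4, by positivity, ?_⟩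
    ext u
    simp only [mem_inter_iff, mem_empty_iff_false, iff_false, not_and]
    intro hu
    apply hsub
    rw [Metric.mem_closedBall] at hu
    rw [Metric.mem_ball]
    linarith
  obtain ⟨k, hk⟩ := hmesh δ hδ
  have hfreq : ∃ᶠ n in atTop, ∃ J ∈ Finset.Ico (0 : ℤ) (2 ^ k),
      φ^[n] (x : UnitAddCircle) ∈ Metric.ball y δ ∧ ⌊F^[k] (F^[n] x)⌋ ≡ J [ZMOD 2 ^ k] := by
    refine (mapClusterPt_iff_frequently.1 hy _ (Metric.ball_mem_nhds y hδ)).mono fun n hn => ?_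
    have hp2 : (0 : ℤ) < 2 ^ k := by positivity
    refine ⟨⌊F^[k] (F^[n] x)⌋ % 2 ^ k, Finset.mem_Ico.2 ⟨Int.emod_nonneg _ hp2.ne',
      Int.emod_lt_of_pos _ hp2⟩, hn, (Int.mod_modEq _ _).symm⟩
  obtain ⟨J, -, hJ⟩ := (Finset.frequently_exists _).1 hfreq
  have hclose : ∀ l, ⌊F^[k] (F^[l] x)⌋ ≡ J [ZMOD 2 ^ k] →
      φ^[l] (x : UnitAddCircle) ∈ Metric.closedBall y (2 * δ) := by
    intro l hl
    obtain ⟨n, hn, hnJ⟩ := hJ.exists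
    have h1 := hF.dist_coe_lt_of_modEq (hk k le_rfl) (hl.trans hnJ.symm)
    rw [← iterate_coe hφ, ← iterate_coe hφ] at h1
    rw [Metric.mem_ball] at hn
    rw [Metric.mem_closedBall]
    have := dist_triangle (φ^[l] (x : UnitAddCircle)) (φ^[n] (x : UnitAddCircle)) y
    linarith
  obtain ⟨N, hN⟩ := hgap k J
  have hO : {u | ∀ i ≤ N, φ^[i] u ∉ Metric.closedBall y (2 * δ)} ∈ 𝓝 a := by
    have : {u | ∀ i ≤ N, φ^[i] u ∉ Metric.closedBall y (2 * δ)} =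
        ⋂ i ∈ Iic N, φ^[i] ⁻¹' (Metric.closedBall y (2 * δ))ᶜ := by
      ext u; simp
    rw [this]
    refine (biInter_mem (finite_Iic N)).2 fun i _ => ?_
    refine (hφc.iterate i).continuousAt.preimage_mem_nhds
      (Metric.isClosed_closedBall.isOpen_compl.mem_nhds fun hcon => ?_)
    have : φ^[i] a ∈ Metric.closedBall y (2 * δ) ∩ P := ⟨hcon, i, rfl⟩
    rw [hball] at this
    exact this
  obtain ⟨m, hm⟩ := (mapClusterPt_iff_frequently.1 ha _ hO).exists
  have hex : ∃ n, ⌊F^[k] (F^[n] (F^[m] x))⌋ ≡ J [ZMOD 2 ^ k] := by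
    obtain ⟨l, hlm, -, hl⟩ := frequently_atTop.1 hJ m
    refine ⟨l - m, ?_⟩
    rwa [← Function.iterate_add_apply F (l - m) m, Nat.sub_add_cancel hlm]
  classical
  have hle := hN m (Nat.find hex) (fun i hi => Nat.find_min hex hi) (Nat.find_spec hex)
  refine hm _ hle ?_
  rw [← Function.iterate_add_apply]
  apply hclose
  rw [Function.iterate_add_apply]
  exact Nat.find_spec hex

/-- The orbit of `x` visits the cells of every limit point which is not a preimage of `0`. -/
lemma exists_modEq_of_mem_omegaLimitPts (hF : NormalizedLift F)
    {φ : UnitAddCircle → UnitAddCircle} (hφ : ∀ x : ℝ, φ x = (F x : ℝ)) {x s : ℝ}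
    (hs : (s : UnitAddCircle) ∈ omegaLimitPts φ (x : UnitAddCircle)) {k : ℕ}
    (hk : ∀ j : ℤ, F^[k] s ≠ j) : ∃ n, ⌊F^[k] (F^[n] x)⌋ ≡ ⌊F^[k] s⌋ [ZMOD 2 ^ k] := by
  set V : Set ℝ := F^[k] ⁻¹' Ioo (⌊F^[k] s⌋ : ℝ) (⌊F^[k] s⌋ + 1) with hV
  have hVo : IsOpen V := isOpen_Ioo.preimage (hF.iterate_continuous k)
  have hsV : s ∈ V := ⟨lt_of_le_of_ne (Int.floor_le _) (hk _).symm, Int.lt_floor_add_one _⟩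
  obtain ⟨n, z, hz, hzn⟩ := (mapClusterPt_iff_frequently.1 hs _
    ((isOpen_coe_image hVo).mem_nhds (mem_image_of_mem _ hsV))).exists
  simp only at hzn
  rw [iterate_coe hφ] at hzn
  obtain ⟨m, hm⟩ := unitAddCircle_coe_eq_coe_iff.1 hzn
  refine ⟨n, ?_⟩
  rw [hm, hF.floor_iterate_add_int]
  have : ⌊F^[k] z⌋ = ⌊F^[k] s⌋ := Int.floor_eq_iff.2 ⟨hz.1.le, hz.2⟩
  rw [this]
  simp [Int.ModEq]

end NormalizedLift

namespace NormalizedLift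

variable {F : ℝ → ℝ}

lemma exists_iterate_sub_eq (hF : NormalizedLift F) (n : ℕ) {a b : ℝ} (hab : a ≤ b) :
    ∃ ξ ∈ Icc a b, F^[n] b - F^[n] a = deriv F^[n] ξ * (b - a) := by
  rcases hab.eq_or_lt with rfl | hab
  · exact ⟨a, by simp, by simp⟩
  obtain ⟨ξ, hξ, h⟩ := exists_deriv_eq_slope F^[n] hab (hF.iterate_continuous n).continuousOn
    (hF.iterate_differentiable n).differentiableOn
  refine ⟨ξ, Ioo_subset_Icc_self hξ, ?_⟩
  rw [h, div_mul_cancel₀ _ (by linarith)]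

lemma sub_le_one_of_iterate_sub_le_one (hF : NormalizedLift F) {n : ℕ} {a b : ℝ}
    (h : F^[n] b - F^[n] a ≤ 1) : b - a ≤ 1 := by
  by_contra hcon
  have h1 := hF.iterate_strictMono n (show a + (1 : ℤ) < b by push_cast; linarith)
  rw [hF.iterate_add_int] at h1
  have h2 : (1 : ℝ) ≤ ((2 ^ n * 1 : ℤ) : ℝ) := by push_cast; simpa using one_le_pow₀ one_le_two
  linarith

/-- Schwartz's argument: if the iterates of `[s, r]` have total length at most `1`, then an
interval `[t, s]` whose last iterate is relatively small has iterates of bounded total length. -/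
lemma sum_iterate_sub_le_two (hF : NormalizedLift F) {L : ℝ} (hL0 : 0 ≤ L)
    (hL : ∀ x y, Real.log (deriv F x) ≤ L * |x - y| + Real.log (deriv F y))
    {n : ℕ} {t s r : ℝ} (hts : t ≤ s) (hsr : s ≤ r)
    (hsum : ∑ i ∈ Finset.range n, (F^[i] r - F^[i] s) ≤ 1)
    (hn1 : F^[n] s - F^[n] t ≤ 1)
    (hn : F^[n] s - F^[n] t ≤ Real.exp (-(3 * L)) * (F^[n] r - F^[n] s)) :
    ∑ i ∈ Finset.range n, (F^[i] r - F^[i] t) ≤ 2 := by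
  have hI : ∀ i, 0 ≤ F^[i] r - F^[i] s := fun i =>
    sub_nonneg.2 ((hF.iterate_strictMono i).monotone hsr)
  have hT : ∀ i, 0 ≤ F^[i] s - F^[i] t := fun i =>
    sub_nonneg.2 ((hF.iterate_strictMono i).monotone hts)
  have key : ∀ q ≤ n, ∀ i, i + q = n → F^[i] s - F^[i] t ≤ F^[i] r - F^[i] s := by
    intro q
    induction q using Nat.strong_induction_on with
    | _ q ih =>
    intro hq i hi
    have hadd : ∀ j z, F^[j] (F^[i] z) = F^[i + j] z := fun j z => by
      rw [← Function.iterate_add_apply, add_comm]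
    obtain ⟨ξ, hξ, hξe⟩ := hF.exists_iterate_sub_eq q
      ((hF.iterate_strictMono i).monotone hts)
    obtain ⟨η, hη, hηe⟩ := hF.exists_iterate_sub_eq q
      ((hF.iterate_strictMono i).monotone hsr)
    have hdist := hF.deriv_iterate_le hL0 hL q (t := F^[i] t) (r := F^[i] r) (x := η) (y := ξ)
      ⟨((hF.iterate_strictMono i).monotone hts).trans hη.1, hη.2⟩
      ⟨hξ.1, hξ.2.trans ((hF.iterate_strictMono i).monotone hsr)⟩
    simp only [hadd, hi] at hξe hηe hdist
    have hS : ∑ j ∈ Finset.range q, (F^[i + j] r - F^[i + j] t) ≤ 3 := by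
      have hsumi : ∑ j ∈ Finset.range q, (F^[i + j] r - F^[i + j] s) ≤ 1 := by
        refine le_trans ?_ hsum
        rw [← hi, Finset.sum_range_add]
        have := Finset.sum_nonneg fun j (_ : j ∈ Finset.range i) => hI j
        linarith
      have hsumt : ∑ j ∈ Finset.range q, (F^[i + j] s - F^[i + j] t) ≤ 2 := by
        rcases q with - | q
        · simp
        have h0 : F^[i] s - F^[i] t ≤ 1 := by
          refine hF.sub_le_one_of_iterate_sub_le_one (n := q + 1) ?_
          rw [hadd, hadd, hi]
          exact hn1
        rw [Finset.sum_range_succ'] at hsumi ⊢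
        have h1 : ∑ j ∈ Finset.range q, (F^[i + (j + 1)] s - F^[i + (j + 1)] t) ≤
            ∑ j ∈ Finset.range q, (F^[i + (j + 1)] r - F^[i + (j + 1)] s) := by
          refine Finset.sum_le_sum fun j hj => ?_
          rw [Finset.mem_range] at hj
          exact ih (q - j) (by omega) (by omega) _ (by omega)
        have h2 := hI (i + 0)
        simp only [add_zero] at h2 hsumi ⊢
        linarith
      have : ∀ j, F^[i + j] r - F^[i + j] t =
          (F^[i + j] r - F^[i + j] s) + (F^[i + j] s - F^[i + j] t) := fun j => by ring
      simp only [this, Finset.sum_add_distrib]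
      linarith
    have hdξ := hF.deriv_iterate_pos q ξ
    have hexp : Real.exp (L * ∑ j ∈ Finset.range q, (F^[i + j] r - F^[i + j] t)) ≤
        Real.exp (3 * L) := by
      rw [mul_comm 3]
      exact Real.exp_le_exp.2 (mul_le_mul_of_nonneg_left hS hL0)
    have h1 : deriv F^[q] η ≤ Real.exp (3 * L) * deriv F^[q] ξ :=
      hdist.trans (mul_le_mul_of_nonneg_right hexp hdξ.le)
    have h2 : deriv F^[q] ξ * (F^[i] s - F^[i] t) ≤ deriv F^[q] ξ * (F^[i] r - F^[i] s) := by
      calc deriv F^[q] ξ * (F^[i] s - F^[i] t) ≤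
            Real.exp (-(3 * L)) * (deriv F^[q] η * (F^[i] r - F^[i] s)) := by
              rw [← hξe, ← hηe]; exact hn
        _ ≤ Real.exp (-(3 * L)) *
            (Real.exp (3 * L) * deriv F^[q] ξ * (F^[i] r - F^[i] s)) := by
              gcongr
              exact hI i
        _ = deriv F^[q] ξ * (F^[i] r - F^[i] s) := by
              rw [← mul_assoc, ← mul_assoc, ← Real.exp_add, neg_add_cancel, Real.exp_zero, one_mul]
    exact le_of_mul_le_mul_left h2 hdξ
  have hle : ∀ i ∈ Finset.range n, F^[i] r - F^[i] t ≤ 2 * (F^[i] r - F^[i] s) := by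
    intro i hi
    rw [Finset.mem_range] at hi
    have := key (n - i) (by omega) i (by omega)
    linarith
  have := Finset.sum_le_sum hle
  rw [← Finset.mul_sum] at this
  linarith

/-- If the complement `B` of an invariant set has positive density in every cell, then the density
points of this invariant set have finite orbits. -/
lemma mem_eventuallyPeriodicPts_of_density (hF : NormalizedLift F)
    {φ : UnitAddCircle → UnitAddCircle} (hφ : ∀ x : ℝ, φ x = (F x : ℝ))
    (h : UnitAddCircle ≃ₜ UnitAddCircle) (hh : ∀ x, h (φ x) = doubling (h x))
    {B : Set ℝ} (hB : MeasurableSet B) (hBp : ∀ (x : ℝ) (m : ℤ), x + m ∈ B ↔ x ∈ B)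
    (hFB : ∀ z, F z ∈ B → z ∈ B) (hpos : ∀ k J, ∃ ε > 0, ¬ SparseIn F B ε k J) {x : ℝ}
    (hx : ∀ ε > 0, ∃ k₀, ∀ k ≥ k₀, SparseIn F B ε k ⌊F^[k] x⌋) :
    (x : UnitAddCircle) ∈ eventuallyPeriodicPts φ := by
  by_contra hxper
  obtain ⟨L, hL0, hL⟩ := hF.exists_lipschitz_log_deriv
  have hmesh : ∀ δ > 0, ∃ k, ∀ l ≥ k, ∀ z, 1 < F^[l] (z + δ) - F^[l] z := fun δ hδ =>
    hF.exists_forall_one_lt_iterate_sub hφ h hh hδ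
  have hgap : ∀ (k : ℕ) (J : ℤ), ∃ N : ℕ, ∀ m n : ℕ,
      (∀ i < n, ¬ ⌊F^[k] (F^[i] (F^[m] x))⌋ ≡ J [ZMOD 2 ^ k]) →
        ⌊F^[k] (F^[n] (F^[m] x))⌋ ≡ J [ZMOD 2 ^ k] → n ≤ N := by
    intro k J
    obtain ⟨ε, hε, hJ⟩ := hpos k J
    exact hF.exists_first_entry_le hB hBp hFB hx hε hJ
  have hφc : Continuous φ := continuous_of_lift hF.continuous hφ
  set Ω := omegaLimitPts φ (x : UnitAddCircle) with hΩ
  have hper : ∀ a ∈ Ω, ∀ p : ℕ, 1 ≤ p → φ^[p] a ≠ a := fun a ha p hp =>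
    hF.iterate_ne_of_mem_omegaLimitPts hφ h hh hmesh hgap hxper ha hp
  have hFΩ : ∀ (n : ℕ) (s : ℝ), (s : UnitAddCircle) ∈ Ω → ((F^[n] s : ℝ) : UnitAddCircle) ∈ Ω :=
    fun n s hs => by rw [← iterate_coe hφ]; exact iterate_mem_omegaLimitPts hφc hs n
  have hadd : ∀ (s : ℝ) (m : ℤ), ((s + m : ℝ) : UnitAddCircle) = s := fun s m =>
    (unitAddCircle_coe_eq_coe_iff.2 ⟨m, rfl⟩).symm
  have hint : ∀ (s : ℝ), (s : UnitAddCircle) ∈ Ω → ∀ (k : ℕ) (j : ℤ), F^[k] s ≠ j := by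
    intro s hs k j hj
    have h1 := hFΩ k s hs
    have h2 := hadd 0 j
    rw [zero_add] at h2
    rw [hj, h2] at h1
    refine hper _ h1 1 le_rfl ?_
    rw [Function.iterate_one, hφ, hF.map_zero]
  obtain ⟨a, haΩ, ha0, ha1, hmax⟩ : ∃ a : ℝ, (a : UnitAddCircle) ∈ Ω ∧ a < 0 ∧ -1 ≤ a ∧
      ∀ b : ℝ, (b : UnitAddCircle) ∈ Ω → b < 0 → b ≤ a := by
    set S : Set ℝ := (fun z : ℝ => (z : UnitAddCircle)) ⁻¹' Ω ∩ Iic 0 with hS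
    have hSc : IsClosed S :=
      (isClosed_omegaLimitPts.preimage (AddCircle.continuous_mk' 1)).inter isClosed_Iic
    have hSb : BddAbove S := ⟨0, fun z hz => hz.2⟩
    obtain ⟨y, hy⟩ : Ω.Nonempty := omegaLimitPts_nonempty
    obtain ⟨b, rfl⟩ := QuotientAddGroup.mk_surjective y
    have hb : b + (-⌈b⌉ : ℤ) ∈ S := by
      refine ⟨?_, ?_⟩
      · show ((b + (-⌈b⌉ : ℤ) : ℝ) : UnitAddCircle) ∈ Ω
        rw [hadd]; exact hy
      · have := Int.le_ceil b
        simp only [mem_Iic]; push_cast; linarith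
    have hmem := hSc.csSup_mem ⟨_, hb⟩ hSb
    refine ⟨sSup S, hmem.1, lt_of_le_of_ne hmem.2 ?_, ?_, fun b hb hb0 => le_csSup hSb ⟨hb, hb0.le⟩⟩
    · have := hint _ hmem.1 0 0
      simpa using this
    · have h1 := le_csSup hSb hb
      have := Int.ceil_lt_add_one b
      push_cast at h1
      linarith
  have hδ : 0 < Real.exp (-(3 * L)) * (-a) := mul_pos (Real.exp_pos _) (by linarith)
  have hδ1 : Real.exp (-(3 * L)) * (-a) ≤ -a :=
    mul_le_of_le_one_left (by linarith) (Real.exp_le_one_iff.2 (by linarith))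
  obtain ⟨k, hk⟩ := hmesh _ hδ
  obtain ⟨u, hu⟩ := hF.iterate_surjective k ⌊F^[k] a⌋
  obtain ⟨v, hv⟩ := hF.iterate_surjective k (⌊F^[k] a⌋ + 1)
  have hauv : a ∈ Ico u v := (hF.mem_Ico_iff hu hv a).2 rfl
  have hvu := hF.sub_lt_of_iterate_sub_le (hk k le_rfl) (t := u) (r := v) (by rw [hu, hv]; linarith)
  obtain ⟨ε, hε, hns⟩ := hpos k ⌊F^[k] a⌋
  obtain ⟨n, hn⟩ := hF.sparseIn_of_visit hB hBp hFB hx (Real.exp (-(L * 2)) * ε) (by positivity)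
  obtain ⟨y, hyΩ, hya⟩ := exists_iterate_eq_of_mem_omegaLimitPts hφc haΩ n
  obtain ⟨s, rfl⟩ := QuotientAddGroup.mk_surjective y
  change (s : UnitAddCircle) ∈ Ω at hyΩ
  change φ^[n] (s : UnitAddCircle) = _ at hya
  rw [iterate_coe hφ] at hya
  obtain ⟨m, hm⟩ := unitAddCircle_coe_eq_coe_iff.1 hya.symm
  obtain ⟨t, ht⟩ := hF.iterate_surjective n (u + m)
  obtain ⟨w, hw⟩ := hF.iterate_surjective n (v + m)
  obtain ⟨r, hr⟩ := hF.iterate_surjective n m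
  have hmono := (hF.iterate_strictMono n)
  have hts : t ≤ s := hmono.le_iff_le.1 (by rw [ht, hm]; linarith [hauv.1])
  have hsw : s < w := hmono.lt_iff_lt.1 (by rw [hw, hm]; linarith [hauv.2])
  have hwr : w ≤ r := hmono.le_iff_le.1 (by rw [hw, hr]; linarith [hauv.1])
  have hgapΩ : ∀ i ≤ n, ∀ z : ℝ, (z : UnitAddCircle) ∈ Ω → z ∉ Ioo (F^[i] s) (F^[i] r) := by
    intro i hi z hz hzI
    have hadd' : ∀ z, F^[n - i] (F^[i] z) = F^[n] z := fun z => by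
      rw [← Function.iterate_add_apply, Nat.sub_add_cancel hi]
    have h1 := hF.iterate_strictMono (n - i) hzI.1
    have h2 := hF.iterate_strictMono (n - i) hzI.2
    rw [hadd', hm] at h1
    rw [hadd', hr] at h2
    have h3 := hmax (F^[n - i] z + (-m : ℤ)) (by rw [hadd]; exact hFΩ _ _ hz)
      (by push_cast; linarith)
    push_cast at h3
    linarith
  have hsum : ∑ i ∈ Finset.range n, (F^[i] r - F^[i] s) ≤ 1 := by
    refine sum_length_le_one n _ _
      (fun i _ => (hF.iterate_strictMono i).monotone (hsw.le.trans hwr)) ?_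
    intro i hi j hj e z hz hze
    have hci := hFΩ i s hyΩ
    have hcj := hFΩ j s hyΩ
    have heq : F^[j] s = F^[i] s + e := by
      rcases lt_trichotomy (F^[j] s) (F^[i] s + e) with hlt | heq | hlt
      · refine absurd ⟨hlt, ?_⟩ (hgapΩ j hj.le (F^[i] s + e) (by rw [hadd]; exact hci))
        linarith [hz.1, hze.2]
      · exact heq
      · refine absurd ⟨?_, ?_⟩ (hgapΩ i hi.le (F^[j] s + (-e : ℤ)) (by rw [hadd]; exact hcj))
        · push_cast; linarith
        · push_cast; linarith [hze.1, hz.2]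
    have hcirc : φ^[i] (s : UnitAddCircle) = φ^[j] (s : UnitAddCircle) := by
      rw [iterate_coe hφ, iterate_coe hφ]
      exact unitAddCircle_coe_eq_coe_iff.2 ⟨e, heq⟩
    have hno : ∀ i j : ℕ, i < j → φ^[i] (s : UnitAddCircle) ≠ φ^[j] (s : UnitAddCircle) := by
      intro i j hij heq
      refine hper _ (iterate_mem_omegaLimitPts hφc hyΩ i) (j - i) (by omega) ?_
      rw [← Function.iterate_add_apply, Nat.sub_add_cancel hij.le]
      exact heq.symm
    rcases lt_trichotomy i j with hij | rfl | hij
    · exact absurd hcirc (hno _ _ hij)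
    · refine ⟨rfl, ?_⟩
      have : (e : ℝ) = 0 := by linarith
      exact_mod_cast this
    · exact absurd hcirc.symm (hno _ _ hij)
  have hS := hF.sum_iterate_sub_le_two hL0 hL hts (hsw.le.trans hwr) hsum
    (by rw [hm, ht]; linarith [hauv.2]) (by
      rw [hm, ht, hr, show (m : ℝ) - (a + m) = -a by ring]
      linarith [hauv.2])
  have hS' : ∑ i ∈ Finset.range n, (F^[i] w - F^[i] t) ≤ 2 :=
    (Finset.sum_le_sum fun i _ =>
      sub_le_sub_right ((hF.iterate_strictMono i).monotone hwr) _).trans hS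
  obtain ⟨l, hl⟩ := hF.exists_modEq_of_mem_omegaLimitPts hφ hyΩ (k := k + n) (hint s hyΩ _)
  have hfl : ⌊F^[k + n] s⌋ = ⌊F^[k] a⌋ + 2 ^ k * m := by
    rw [Function.iterate_add_apply, hm, hF.floor_iterate_add_int]
  have hsp := hn (k + n) (by omega) l _ hl t w
    (by rw [hfl, Function.iterate_add_apply, ht, hF.iterate_add_int, hu]; push_cast; ring)
    (by rw [hfl, Function.iterate_add_apply, hw, hF.iterate_add_int, hv]; push_cast; ring)
  have hFBn : ∀ i z, F^[i] z ∈ B → z ∈ B := by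
    intro i
    induction i with
    | zero => exact fun z hz => hz
    | succ i ih => exact fun z hz => hFB z (ih _ hz)
  have hfin := hF.volume_inter_Ico_iterate_le hL0 hL n (hts.trans hsw.le) hB (C := B)
    (fun z _ hz => hFBn n z hz) hS' hsp
  rw [← mul_assoc, ← Real.exp_add, add_neg_cancel, Real.exp_zero, one_mul, ht, hw] at hfin
  refine hns (hF.sparseIn_add hBp (J := ⌊F^[k] a⌋ + 2 ^ k * m) ?_ (by simp [Int.ModEq]))
  intro t' w' ht' hw'
  obtain rfl : t' = u + m := (hF.iterate_strictMono k).injective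
    (by rw [ht', hF.iterate_add_int, hu]; push_cast; ring)
  obtain rfl : w' = v + m := (hF.iterate_strictMono k).injective
    (by rw [hw', hF.iterate_add_int, hv]; push_cast; ring)
  exact hfin

end NormalizedLift

namespace NormalizedLift

variable {F : ℝ → ℝ}

lemma ae_notMem_avoidingSet (hF : NormalizedLift F)
    {φ : UnitAddCircle → UnitAddCircle} (hφ : ∀ x : ℝ, φ x = (F x : ℝ))
    (h : UnitAddCircle ≃ₜ UnitAddCircle) (hh : ∀ x, h (φ x) = doubling (h x))
    (κ : ℕ) (K : ℤ) : ∀ᵐ x, x ∉ avoidingSet F κ K := by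
  have hcount := (countable_coe_preimage (countable_eventuallyPeriodicPts h hh)).ae_notMem volume
  have hmeas := hF.measurableSet_avoidingSet κ K
  filter_upwards [hcount, hF.ae_sparseIn_compl
    (fun δ hδ => hF.exists_forall_one_lt_iterate_sub hφ h hh hδ) hmeas] with x hx hdens hxE
  refine hx (hF.mem_eventuallyPeriodicPts_of_density hφ h hh hmeas.compl ?_ ?_
    (hF.exists_not_sparseIn_compl_avoidingSet κ K) (hdens hxE))
  · exact fun z m => not_congr (hF.add_int_mem_avoidingSet_iff κ K z m)
  · exact fun z hz hcon => hz (map_mem_avoidingSet hcon)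

/-- `F` is ergodic with respect to the Lebesgue measure class modulo `1`. -/
lemma volume_eq_zero_or_compl (hF : NormalizedLift F)
    {φ : UnitAddCircle → UnitAddCircle} (hφ : ∀ x : ℝ, φ x = (F x : ℝ))
    (h : UnitAddCircle ≃ₜ UnitAddCircle) (hh : ∀ x, h (φ x) = doubling (h x))
    {A : Set ℝ} (hA : MeasurableSet A) (hAp : ∀ (x : ℝ) (m : ℤ), x + m ∈ A ↔ x ∈ A)
    (hFA : ∀ z ∈ A, F z ∈ A) : volume A = 0 ∨ volume Aᶜ = 0 := by
  by_contra! hcon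
  have hmesh : ∀ δ > 0, ∃ k, ∀ l ≥ k, ∀ z, 1 < F^[l] (z + δ) - F^[l] z := fun δ hδ =>
    hF.exists_forall_one_lt_iterate_sub hφ h hh hδ
  have hav : ∀ᵐ x, ∀ (κ : ℕ) (K : ℤ), x ∉ avoidingSet F κ K :=
    ae_all_iff.2 fun κ => ae_all_iff.2 fun K => hF.ae_notMem_avoidingSet hφ h hh κ K
  obtain ⟨x, hxA, hx, hxav⟩ := ((frequently_ae_mem_iff.2 hcon.1).and_eventually
    ((hF.ae_sparseIn_compl hmesh hA).and hav)).exists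
  obtain ⟨z, hzA, hz⟩ := ((frequently_ae_mem_iff.2 hcon.2).and_eventually
    (hF.ae_sparseIn_compl hmesh hA.compl)).exists
  obtain ⟨k₁, hk₁⟩ := hF.sparseIn_of_visit hA.compl (fun z m => not_congr (hAp z m))
    (fun z hz hcon => hz (hFA z hcon)) (hx hxA) (1 / 3) (by norm_num)
  obtain ⟨k₂, hk₂⟩ := hz hzA (1 / 3) (by norm_num)
  rw [compl_compl] at hk₂
  set k := max k₁ k₂
  have hvisit := hxav k ⌊F^[k] z⌋
  simp only [avoidingSet, mem_ofPred_eq, not_forall, not_not] at hvisit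
  obtain ⟨n, hn⟩ := hvisit
  obtain ⟨t, ht⟩ := hF.iterate_surjective k ⌊F^[k] z⌋
  obtain ⟨r, hr⟩ := hF.iterate_surjective k (⌊F^[k] z⌋ + 1)
  have htr : t < r := (hF.iterate_strictMono k).lt_iff_lt.1 (by rw [ht, hr]; linarith)
  have h1 := hk₁ k (le_max_left _ _) n _ hn t r ht hr
  have h2 := hk₂ k (le_max_right _ _) t r ht hr
  have h3 := measureReal_inter_add_sdiff (μ := volume) (s := Ico t r) hA (by simp)
  rw [Real.volume_real_Ico_of_le htr.le, inter_comm, sdiff_eq, inter_comm _ Aᶜ] at h3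
  linarith

end NormalizedLift

lemma IsOPLift.image_closedArc {g : UnitAddCircle → UnitAddCircle} {R : ℝ → ℝ}
    (hg : IsOPLift g R) {a b : ℝ} (hab : a ≤ b) :
    g '' ((fun t : ℝ => (t : UnitAddCircle)) '' Icc a b) =
      (fun t : ℝ => (t : UnitAddCircle)) '' Icc (R a) (R b) := by
  obtain ⟨hc, hm, -, hlift⟩ := hg
  have himg : R '' Icc a b = Icc (R a) (R b) := by
    refine Subset.antisymm ?_ (intermediate_value_Icc hab hc.continuousOn)
    rintro _ ⟨x, hx, rfl⟩
    exact ⟨hm.monotone hx.1, hm.monotone hx.2⟩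
  rw [← himg, image_image, image_image]
  exact image_congr fun x _ => hlift x

lemma IsOPLift.bijective {g : UnitAddCircle → UnitAddCircle} {R : ℝ → ℝ}
    (hg : IsOPLift g R) : Function.Bijective g := by
  have himg := hg.image_closedArc (zero_le_one' ℝ)
  obtain ⟨-, hm, hR1, hlift⟩ := hg
  have hRm : ∀ (x : ℝ) (m : ℤ), R (x + m) = R x + m := by
    intro x m
    have hp : Function.Periodic (fun x => R x - x) 1 := fun x => by simp only [hR1]; ring
    have := hp.int_mul m x
    simp only [mul_one] at this
    linarith
  constructor
  · intro x y hxy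
    obtain ⟨x, rfl⟩ := QuotientAddGroup.mk_surjective x
    obtain ⟨y, rfl⟩ := QuotientAddGroup.mk_surjective y
    change g (x : UnitAddCircle) = g (y : UnitAddCircle) at hxy
    rw [hlift, hlift] at hxy
    obtain ⟨m, hm'⟩ := unitAddCircle_coe_eq_coe_iff.1 hxy
    rw [← hRm] at hm'
    exact unitAddCircle_coe_eq_coe_iff.2 ⟨m, hm.injective hm'⟩
  · intro y
    have huniv : (fun t : ℝ => (t : UnitAddCircle)) '' Icc (R 0) (R 1) = univ := by
      have := hR1 0
      rw [zero_add] at this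
      rw [this]
      exact AddCircle.coe_image_Icc_eq 1 (R 0)
    have hy : y ∈ (fun t : ℝ => (t : UnitAddCircle)) '' Icc (R 0) (R 1) := huniv ▸ mem_univ y
    rw [← himg] at hy
    obtain ⟨x, -, hx⟩ := hy
    exact ⟨x, hx⟩

lemma interior_eq_empty_of_countable {s : Set UnitAddCircle} (hs : s.Countable) :
    interior s = ∅ := by
  refine Measure.interior_eq_empty_of_null (μ := volume) ?_
  rw [← (UnitAddCircle.measurePreserving_mk 0).measure_preimage hs.measurableSet.nullMeasurableSet]
  exact (countable_coe_preimage hs).measure_zero _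

lemma countable_inter_chain {r : ℕ} {a : ℕ → ℝ} (ha : ∀ i < r, a i < a (i + 1)) (ha0 : a 0 = 0)
    (har : a r = 1) {i j : ℕ} (hij : i < j) (hj : j < r) :
    (((fun t : ℝ => (t : UnitAddCircle)) '' Icc (a i) (a (i + 1))) ∩
      ((fun t : ℝ => (t : UnitAddCircle)) '' Icc (a j) (a (j + 1)))).Countable := by
  have hmono : ∀ j ≤ r, ∀ i ≤ j, a i ≤ a j := by
    intro j
    induction j with
    | zero => intro _ i hi; rw [Nat.le_zero.1 hi]
    | succ j ih =>
      intro hj i hi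
      rcases Nat.le_succ_iff.1 hi with h | rfl
      · exact (ih (by omega) i h).trans (ha j (by omega)).le
      · exact le_rfl
  refine (Set.toFinite {((a j : ℝ) : UnitAddCircle), ((0 : ℝ) : UnitAddCircle)}).countable.mono ?_
  rintro _ ⟨⟨s, hs, rfl⟩, ⟨t, ht, hts⟩⟩
  obtain ⟨m, hm⟩ := unitAddCircle_coe_eq_coe_iff.1 hts
  have h1 := hmono j hj.le (i + 1) hij
  have h2 := hmono r le_rfl (j + 1) hj
  have h3 := hmono i (by omega) 0 (by omega)
  rw [ha0] at h3
  rw [har] at h2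
  have hm0 : (m : ℝ) ≤ 0 := by linarith [hs.2, ht.1]
  have hm1 : (-1 : ℝ) ≤ m := by linarith [hs.1, ht.2]
  have hm0' : m ≤ 0 := by exact_mod_cast hm0
  have hm1' : -1 ≤ m := by exact_mod_cast hm1
  obtain rfl | rfl : m = 0 ∨ m = -1 := by omega
  · left
    have : s = a j := by
      push_cast at hm
      linarith [hs.2, ht.1]
    rw [this]
  · right
    have : s = 0 := by
      push_cast at hm
      linarith [hs.1, ht.2]
    rw [this]; rfl

/-- A homeomorphism of the circle which is piecewise conjugate to powers of `φ` along a chain of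
dyadic intervals belongs to the Thompson group. -/
lemma inThompsonGroup_of_chain {φ : UnitAddCircle → UnitAddCircle} {F : ℝ → ℝ}
    (hφ : ∀ x : ℝ, φ x = (F x : ℝ)) {g : UnitAddCircle → UnitAddCircle} {R : ℝ → ℝ}
    (hg : IsOPLift g R) {r : ℕ} (hr : 0 < r) {a : ℕ → ℝ} {n m : ℕ → ℕ}
    (ha : ∀ i < r, a i < a (i + 1)) (ha0 : a 0 = 0) (har : a r = 1)
    (hn : ∀ i < r, (∃ k : ℤ, F^[n i] (a i) = k) ∧ F^[n i] (a (i + 1)) = F^[n i] (a i) + 1)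
    (hR : ∀ i < r, ∃ c : ℤ, ∀ x ∈ Icc (a i) (a (i + 1)), F^[m i] (R x) = F^[n i] x + c) :
    InThompsonGroup φ F g := by
  have hcover : (⋃ k : Fin r, (fun t : ℝ => (t : UnitAddCircle)) '' Icc (a k) (a (k + 1))) =
      univ := by
    refine eq_univ_of_forall fun y => ?_
    have hy : y ∈ (fun t : ℝ => (t : UnitAddCircle)) '' Icc 0 (0 + 1) := by
      have := AddCircle.coe_image_Icc_eq 1 (0 : ℝ)
      exact this ▸ mem_univ y
    obtain ⟨t, ht, rfl⟩ := hy
    have hex : ∀ j ≤ r, t ≤ a j → ∃ i < r, t ∈ Icc (a i) (a (i + 1)) := by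
      intro j
      induction j with
      | zero =>
        intro _ h
        exact ⟨0, hr, by rw [ha0]; exact ht.1, h.trans (ha 0 hr).le⟩
      | succ j ih =>
        intro hj h
        rcases le_total t (a j) with h' | h'
        · exact ih (by omega) h'
        · exact ⟨j, by omega, h', h⟩
    obtain ⟨i, hi, hti⟩ := hex r le_rfl (by rw [har]; linarith [ht.2])
    exact mem_iUnion.2 ⟨⟨i, hi⟩, t, hti, rfl⟩
  have himg : ∀ k : Fin r, g '' ((fun t : ℝ => (t : UnitAddCircle)) '' Icc (a k) (a (k + 1))) =
      (fun t : ℝ => (t : UnitAddCircle)) '' Icc (R (a k)) (R (a (k + 1))) :=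
    fun k => hg.image_closedArc (ha k k.2).le
  have hinter : Pairwise fun k l : Fin r =>
      (((fun t : ℝ => (t : UnitAddCircle)) '' Icc (a k) (a (k + 1))) ∩
        ((fun t : ℝ => (t : UnitAddCircle)) '' Icc (a l) (a (l + 1)))).Countable := by
    intro k l hkl
    rcases lt_or_gt_of_ne hkl with h | h
    · exact countable_inter_chain ha ha0 har h l.2
    · rw [inter_comm]; exact countable_inter_chain ha ha0 har h k.2
  refine ⟨⟨R, hg⟩, r, fun k => (fun t : ℝ => (t : UnitAddCircle)) '' Icc (a k) (a (k + 1)),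
    fun k => (fun t : ℝ => (t : UnitAddCircle)) '' Icc (R (a k)) (R (a (k + 1))),
    fun k => n k, fun k => m k, hr, fun k => ?_, fun k => ?_, hcover, ?_, ?_, ?_, himg, ?_⟩
  · exact ⟨a k, a (k + 1), ha k k.2, (hn k k.2).1, (hn k k.2).2, rfl⟩
  · obtain ⟨c, hc⟩ := hR k k.2
    have hk := ha k k.2
    have h1 := hc (a k) ⟨le_rfl, hk.le⟩
    have h2 := hc (a (k + 1)) ⟨hk.le, le_rfl⟩
    obtain ⟨⟨j, hj⟩, hj1⟩ := hn k k.2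
    refine ⟨R (a k), R (a (k + 1)), hg.2.1 hk, ⟨j + c, ?_⟩, ?_, rfl⟩
    · rw [h1, hj]; push_cast; ring
    · rw [h1, h2, hj1]; ring
  · simp only [← himg]
    rw [← image_iUnion, hcover, image_univ, hg.bijective.surjective.range_eq]
  · intro k l hkl
    rw [← interior_inter]
    exact interior_eq_empty_of_countable (hinter hkl)
  · intro k l hkl
    rw [← interior_inter]
    simp only [← himg]
    rw [← image_inter hg.bijective.injective]
    exact interior_eq_empty_of_countable ((hinter hkl).image g)
  · rintro k _ ⟨x, hx, rfl⟩
    obtain ⟨c, hc⟩ := hR k k.2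
    simp only
    rw [hg.2.2.2, iterate_coe hφ, iterate_coe hφ]
    refine (unitAddCircle_coe_eq_coe_iff.2 ⟨c, hc x hx⟩).symm

lemma exists_isOPLift {R : ℝ → ℝ} (hc : Continuous R) (hm : StrictMono R)
    (h1 : ∀ x, R (x + 1) = R x + 1) : ∃ g, IsOPLift g R := by
  have hp : Function.Periodic (fun x => (R x : UnitAddCircle)) 1 := fun x => by
    simp only [h1]
    exact (unitAddCircle_coe_eq_coe_iff.2 ⟨1, by simp⟩).symm
  exact ⟨hp.lift, hc, hm, h1, fun x => hp.lift_coe x⟩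

/-- A set invariant under the Thompson group is invariant under lifts of its elements. -/
lemma coe_mem_iff_of_chain {φ : UnitAddCircle → UnitAddCircle} {F : ℝ → ℝ}
    (hφ : ∀ x : ℝ, φ x = (F x : ℝ)) {A : Set UnitAddCircle}
    (hinv : ∀ g, InThompsonGroup φ F g → g '' A = A) {R : ℝ → ℝ} (hc : Continuous R)
    (hm : StrictMono R) (h1 : ∀ x, R (x + 1) = R x + 1) {r : ℕ} (hr : 0 < r) {a : ℕ → ℝ}
    {n m : ℕ → ℕ} (ha : ∀ i < r, a i < a (i + 1)) (ha0 : a 0 = 0) (har : a r = 1)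
    (hn : ∀ i < r, (∃ k : ℤ, F^[n i] (a i) = k) ∧ F^[n i] (a (i + 1)) = F^[n i] (a i) + 1)
    (hR : ∀ i < r, ∃ c : ℤ, ∀ x ∈ Icc (a i) (a (i + 1)), F^[m i] (R x) = F^[n i] x + c) (x : ℝ) :
    (R x : UnitAddCircle) ∈ A ↔ (x : UnitAddCircle) ∈ A := by
  obtain ⟨g, hg⟩ := exists_isOPLift hc hm h1
  have := hinv g (inThompsonGroup_of_chain hφ hg hr ha ha0 har hn hR)
  rw [← hg.2.2.2]
  conv_lhs => rw [← this]
  exact hg.bijective.injective.mem_set_image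

/-- Extension of an increasing homeomorphism of `[0, 1]` to a lift of a circle homeomorphism. -/
def periodicExtension (f : ℝ → ℝ) (x : ℝ) : ℝ := f (Int.fract x) + ⌊x⌋

section periodicExtension

variable {f : ℝ → ℝ}

lemma periodicExtension_add_one (x : ℝ) :
    periodicExtension f (x + 1) = periodicExtension f x + 1 := by
  simp only [periodicExtension, Int.fract_add_one, Int.floor_add_one]
  push_cast; ring

lemma periodicExtension_of_mem_Icc (h0 : f 0 = 0) (h1 : f 1 = 1) {x : ℝ} (hx : x ∈ Icc (0 : ℝ) 1) :
    periodicExtension f x = f x := by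
  rcases hx.2.eq_or_lt with rfl | hlt
  · simp [periodicExtension, h0, h1]
  · have : ⌊x⌋ = 0 := Int.floor_eq_zero_iff.2 ⟨hx.1, hlt⟩
    simp [periodicExtension, Int.fract, this]

lemma strictMono_periodicExtension (hf : StrictMono f) (h0 : f 0 = 0) (h1 : f 1 = 1) :
    StrictMono (periodicExtension f) := by
  intro x y hxy
  rcases (Int.floor_mono hxy.le).eq_or_lt with heq | hlt
  · have : Int.fract x < Int.fract y := by
      rw [Int.fract, Int.fract, heq]; linarith
    simp only [periodicExtension, heq]
    linarith [hf this]
  · have e1 := hf (Int.fract_lt_one x)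
    have e2 := hf.monotone (Int.fract_nonneg y)
    have e3 : (⌊x⌋ : ℝ) + 1 ≤ ⌊y⌋ := by exact_mod_cast hlt
    simp only [periodicExtension]
    linarith

lemma continuous_periodicExtension (hf : Continuous f) (h0 : f 0 = 0) (h1 : f 1 = 1) :
    Continuous (periodicExtension f) := by
  have h2 : Continuous ((fun x => f x - x) ∘ Int.fract) :=
    ContinuousOn.comp_fract'' (hf.sub continuous_id).continuousOn (by simp [h0, h1])
  have h3 : periodicExtension f = fun x => ((fun x => f x - x) ∘ Int.fract) x + x := by
    ext x
    have := Int.fract_add_floor x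
    simp only [periodicExtension, Function.comp_apply]
    linarith
  rw [h3]
  exact h2.add continuous_id

end periodicExtension

lemma InThompsonGroup.of_iterate_eq_add {φ : UnitAddCircle → UnitAddCircle} {F G : ℝ → ℝ}
    (h : ∀ n, ∃ c : ℤ, ∀ x, F^[n] x = G^[n] x + c) {g : UnitAddCircle → UnitAddCircle}
    (hg : InThompsonGroup φ G g) : InThompsonGroup φ F g := by
  have hdy : ∀ n I, IsDyadic G n I → IsDyadic F n I := by
    rintro n I ⟨a, b, hab, ⟨k, hk⟩, hb, hI⟩
    obtain ⟨c, hc⟩ := h n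
    refine ⟨a, b, hab, ⟨k + c, ?_⟩, ?_, hI⟩
    · rw [hc, hk]; push_cast; rfl
    · rw [hc, hc, hb]; ring
  obtain ⟨hlift, r, I, J, n, m, hr, hI, hJ, hrest⟩ := hg
  exact ⟨hlift, r, I, J, n, m, hr, fun k => hdy _ _ (hI k), fun k => hdy _ _ (hJ k), hrest⟩

namespace NormalizedLift

variable {F : ℝ → ℝ}

/-- A normalized lift as an order isomorphism. -/
def orderIso (hF : NormalizedLift F) : ℝ ≃o ℝ :=
  hF.strictMono.orderIsoOfSurjective F hF.surjective

lemma apply_symm (hF : NormalizedLift F) (x : ℝ) : F (hF.orderIso.symm x) = x :=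
  hF.orderIso.apply_symm_apply x

lemma symm_apply (hF : NormalizedLift F) (x : ℝ) : hF.orderIso.symm (F x) = x :=
  hF.orderIso.symm_apply_apply x

/-- The lift of the Thompson group element exchanging the two dyadic intervals of degree one. -/
def halfTurn (hF : NormalizedLift F) (x : ℝ) : ℝ := hF.orderIso.symm (F x + 1)

lemma map_halfTurn (hF : NormalizedLift F) (x : ℝ) : F (hF.halfTurn x) = F x + 1 :=
  hF.apply_symm _

lemma halfTurn_mem_iff (hF : NormalizedLift F) {φ : UnitAddCircle → UnitAddCircle}
    (hφ : ∀ x : ℝ, φ x = (F x : ℝ)) {A : Set UnitAddCircle}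
    (hinv : ∀ g, InThompsonGroup φ F g → g '' A = A) (x : ℝ) :
    (hF.halfTurn x : UnitAddCircle) ∈ A ↔ (x : UnitAddCircle) ∈ A := by
  have hF1 : F 1 = 2 := by simpa [hF.map_zero] using hF.map_add_one 0
  have hp := hF.apply_symm 1
  set p := hF.orderIso.symm 1
  have hp0 : 0 < p := hF.strictMono.lt_iff_lt.1 (by rw [hp, hF.map_zero]; norm_num)
  have hp1 : p < 1 := hF.strictMono.lt_iff_lt.1 (by rw [hp, hF1]; norm_num)
  refine coe_mem_iff_of_chain hφ hinv (R := hF.halfTurn) (r := 2)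
    (a := fun i => if i = 0 then 0 else if i = 1 then p else 1) (n := fun _ => 1) (m := fun _ => 1)
    ?_ ?_ ?_ two_pos ?_ (by simp) (by simp) ?_ ?_ x
  · exact hF.orderIso.symm.continuous.comp (hF.continuous.add continuous_const)
  · exact fun x y hxy => hF.orderIso.symm.strictMono (by linarith [hF.strictMono hxy])
  · intro x
    apply hF.strictMono.injective
    rw [hF.map_halfTurn, hF.map_add_one, hF.map_add_one, hF.map_halfTurn]
    ring
  · intro i hi
    interval_cases i <;> simp [hp0, hp1]
  · intro i hi
    interval_cases i
    · exact ⟨⟨0, by simp [hF.map_zero]⟩, by simp [hF.map_zero, hp]⟩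
    · exact ⟨⟨1, by simp [hp]⟩, by simp [hp, hF1]; norm_num⟩
  · exact fun i _ => ⟨1, fun x _ => by simp [hF.map_halfTurn]⟩

/-- The restriction to `[0, 1]` of a lift of the Thompson group element which maps the dyadic
intervals `[0, 1/4], [1/4, 1/2], [1/2, 1]` of the model to `[0, 1/2], [1/2, 3/4], [3/4, 1]`. -/
def stretch (hF : NormalizedLift F) (x : ℝ) : ℝ :=
  if F (F x) ≤ 1 then F x
  else if F x ≤ 1 then hF.orderIso.symm (hF.orderIso.symm (F (F x) + 1))
  else hF.orderIso.symm (hF.orderIso.symm (F x + 2))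

lemma stretch_of_le (hF : NormalizedLift F) {x : ℝ} (hx : F (F x) ≤ 1) : hF.stretch x = F x :=
  if_pos hx

lemma map_one (hF : NormalizedLift F) : F 1 = 2 := by
  simpa [hF.map_zero] using hF.map_add_one 0

lemma map_two (hF : NormalizedLift F) : F 2 = 4 := by
  have := hF.map_add_one 1
  rw [hF.map_one] at this
  norm_num at this
  exact this

lemma map_map_stretch_of_mem (hF : NormalizedLift F) {x : ℝ} (h1 : 1 ≤ F (F x)) (h2 : F x ≤ 1) :
    F (F (hF.stretch x)) = F (F x) + 1 := by
  rw [stretch]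
  split_ifs with h
  · rw [le_antisymm h h1, hF.map_one]; norm_num
  · rw [hF.apply_symm, hF.apply_symm]

lemma map_map_stretch_of_le (hF : NormalizedLift F) {x : ℝ} (hx : 1 ≤ F x) :
    F (F (hF.stretch x)) = F x + 2 := by
  have hlt : ¬ F (F x) ≤ 1 := by
    have := hF.strictMono.monotone hx
    rw [hF.map_one] at this
    linarith
  rw [stretch, if_neg hlt]
  split_ifs with h
  · rw [hF.apply_symm, hF.apply_symm, le_antisymm h hx, hF.map_one]; norm_num
  · rw [hF.apply_symm, hF.apply_symm]

lemma strictMono_stretch (hF : NormalizedLift F) : StrictMono hF.stretch := by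
  have hF2 : StrictMono fun x => F (F (hF.stretch x)) := by
    intro x y hxy
    have e1 := hF.strictMono hxy
    have e2 := hF.strictMono e1
    have e3 := hF.strictMono e2
    simp only
    rcases le_total (F (F x)) 1 with hx | hx
    · rw [hF.stretch_of_le hx]
      have hx' := hF.strictMono.monotone hx
      rw [hF.map_one] at hx'
      rcases le_or_gt (F (F y)) 1 with hy | hy
      · rwa [hF.stretch_of_le hy]
      rcases le_total (F y) 1 with hy2 | hy2
      · rw [hF.map_map_stretch_of_mem hy.le hy2]; linarith
      · rw [hF.map_map_stretch_of_le hy2]; linarith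
    · rcases le_total (F x) 1 with hx2 | hx2
      · rw [hF.map_map_stretch_of_mem hx hx2]
        rcases le_total (F y) 1 with hy2 | hy2
        · rw [hF.map_map_stretch_of_mem (by linarith) hy2]; linarith
        · rw [hF.map_map_stretch_of_le hy2]
          have := hF.strictMono.monotone hx2
          rw [hF.map_one] at this
          rcases hx2.eq_or_lt with h | h
          · rw [h, hF.map_one]; linarith
          · have := hF.strictMono h
            rw [hF.map_one] at this
            linarith
      · rw [hF.map_map_stretch_of_le hx2, hF.map_map_stretch_of_le (by linarith)]; linarith
  exact fun x y hxy => hF.strictMono.lt_iff_lt.1 (hF.strictMono.lt_iff_lt.1 (hF2 hxy))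

lemma continuous_stretch (hF : NormalizedLift F) : Continuous hF.stretch := by
  have hc := hF.continuous
  have hs := hF.orderIso.symm.continuous
  refine Continuous.if_le hc (Continuous.if_le ?_ ?_ hc continuous_const ?_)
    (hc.comp hc) continuous_const ?_
  · exact hs.comp (hs.comp ((hc.comp hc).add continuous_const))
  · exact hs.comp (hs.comp (hc.add continuous_const))
  · intro x hx
    rw [hx, hF.map_one]; norm_num
  · intro x hx
    have h1 : F x ≤ 1 := by
      rw [← hF.strictMono.le_iff_le, hx, hF.map_one]; norm_num
    have := hF.map_one
    rw [if_pos h1, hx, show (1 : ℝ) + 1 = F 1 by rw [this]; norm_num, hF.symm_apply, ← hx,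
      hF.symm_apply]

lemma stretch_zero (hF : NormalizedLift F) : hF.stretch 0 = 0 := by
  rw [hF.stretch_of_le] <;> simp [hF.map_zero]

lemma stretch_one (hF : NormalizedLift F) : hF.stretch 1 = 1 := by
  apply hF.strictMono.injective
  apply hF.strictMono.injective
  rw [hF.map_map_stretch_of_le] <;> rw [hF.map_one]
  · rw [hF.map_two]; norm_num
  · norm_num

lemma stretch_mem_iff (hF : NormalizedLift F) {φ : UnitAddCircle → UnitAddCircle}
    (hφ : ∀ x : ℝ, φ x = (F x : ℝ)) {A : Set UnitAddCircle}
    (hinv : ∀ g, InThompsonGroup φ F g → g '' A = A) {x : ℝ} (hx : x ∈ Icc (0 : ℝ) 1) :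
    (hF.stretch x : UnitAddCircle) ∈ A ↔ (x : UnitAddCircle) ∈ A := by
  have hext : ∀ y ∈ Icc (0 : ℝ) 1, periodicExtension hF.stretch y = hF.stretch y := fun y hy =>
    periodicExtension_of_mem_Icc hF.stretch_zero hF.stretch_one hy
  rw [← hext x hx]
  have hF1 := hF.map_one
  have hF2 := hF.map_two
  have hp := hF.apply_symm 1
  have hq := hF.apply_symm (hF.orderIso.symm 1)
  set p := hF.orderIso.symm 1
  set q := hF.orderIso.symm p
  have hp0 : 0 < p := hF.strictMono.lt_iff_lt.1 (by rw [hp, hF.map_zero]; norm_num)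
  have hp1 : p < 1 := hF.strictMono.lt_iff_lt.1 (by rw [hp, hF1]; norm_num)
  have hq0 : 0 < q := hF.strictMono.lt_iff_lt.1 (by rw [hq, hF.map_zero]; exact hp0)
  have hqp : q < p := hF.strictMono.lt_iff_lt.1 (by rw [hq, hp]; exact hp1)
  refine coe_mem_iff_of_chain hφ hinv (R := periodicExtension hF.stretch) (r := 3)
    (a := fun i => if i = 0 then 0 else if i = 1 then q else if i = 2 then p else 1)
    (n := fun i => if i = 2 then 1 else 2) (m := fun i => if i = 0 then 1 else 2)
    (continuous_periodicExtension hF.continuous_stretch hF.stretch_zero hF.stretch_one)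
    (strictMono_periodicExtension hF.strictMono_stretch hF.stretch_zero hF.stretch_one)
    periodicExtension_add_one three_pos ?_ (by simp) (by simp) ?_ ?_ x
  · intro i hi
    interval_cases i <;> simp [hp1, hq0, hqp]
  · intro i hi
    interval_cases i
    · exact ⟨⟨0, by simp [hF.map_zero]⟩, by simp [hF.map_zero, hp, hq]⟩
    · exact ⟨⟨1, by simp [hp, hq]⟩, by simp [hp, hq, hF1]; norm_num⟩
    · exact ⟨⟨1, by simp [hp]⟩, by simp [hp, hF1]; norm_num⟩
  · have hmono := hF.strictMono.monotone
    intro i hi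
    interval_cases i
    · refine ⟨0, fun y hy => ?_⟩
      simp only [↓reduceIte, zero_add, one_ne_zero] at hy
      rw [hext y ⟨hy.1, by linarith [hy.2]⟩, hF.stretch_of_le]
      · simp
      · rw [← hp, ← hq]; exact hmono (hmono hy.2)
    · refine ⟨1, fun y hy => ?_⟩
      simp at hy
      rw [hext y ⟨by linarith [hy.1], by linarith [hy.2]⟩]
      have := hF.map_map_stretch_of_mem (x := y) (by rw [← hp, ← hq]; exact hmono (hmono hy.1))
        (by rw [← hp]; exact hmono hy.2)
      simpa using this
    · refine ⟨2, fun y hy => ?_⟩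
      simp at hy
      rw [hext y ⟨by linarith [hy.1], by linarith [hy.2]⟩]
      have := hF.map_map_stretch_of_le (x := y) (by rw [← hp]; exact hmono hy.1)
      simpa using this

/-- Every set invariant under the Thompson group is invariant under `φ`. -/
lemma map_mem_iff (hF : NormalizedLift F) {φ : UnitAddCircle → UnitAddCircle}
    (hφ : ∀ x : ℝ, φ x = (F x : ℝ)) {A : Set UnitAddCircle}
    (hinv : ∀ g, InThompsonGroup φ F g → g '' A = A) (x : ℝ) :
    (F x : UnitAddCircle) ∈ A ↔ (x : UnitAddCircle) ∈ A := by
  have hmono := hF.strictMono.monotone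
  have hinj := hF.strictMono.injective
  have hF1 := hF.map_one
  have hF2 := hF.map_two
  have hshift : ∀ y : ℝ, ((y - 1 : ℝ) : UnitAddCircle) = y := fun y =>
    unitAddCircle_coe_eq_coe_iff.2 ⟨1, by simp⟩
  have hmain : ∀ x ∈ Icc (0 : ℝ) 1, (F x : UnitAddCircle) ∈ A ↔ (x : UnitAddCircle) ∈ A := by
    intro x hx
    have hFx0 : 0 ≤ F x := by simpa [hF.map_zero] using hmono hx.1
    have hFx2 : F x ≤ 2 := by simpa [hF1] using hmono hx.2
    have hFs : ∀ y, F (y - 1) = F y - 2 := fun y => by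
      have := hF.map_add_one (y - 1)
      rw [sub_add_cancel] at this
      linarith
    rcases le_total (F x) 1 with h1 | h1
    · rcases le_total (F (F x)) 1 with h2 | h2
      · rw [← hF.stretch_of_le h2]
        exact hF.stretch_mem_iff hφ hinv hx
      · rw [← hF.stretch_mem_iff hφ hinv ⟨hFx0, h1⟩, ← hF.halfTurn_mem_iff hφ hinv x,
          show hF.stretch (F x) = hF.halfTurn x from hinj (hinj ?_)]
        rw [hF.map_map_stretch_of_le h2, hF.map_halfTurn, hF.map_add_one]
    · rcases le_total (F (F x)) 3 with h2 | h2
      · have h3 : F (hF.halfTurn x - 1) = F x - 1 := by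
          rw [hFs, hF.map_halfTurn]; ring
        have h4 : hF.halfTurn x - 1 ∈ Icc (0 : ℝ) 1 :=
          ⟨hF.strictMono.le_iff_le.1 (by rw [h3, hF.map_zero]; linarith),
            hF.strictMono.le_iff_le.1 (by rw [h3, hF1]; linarith)⟩
        rw [← hF.halfTurn_mem_iff hφ hinv x, ← hshift (hF.halfTurn x),
          ← hF.stretch_mem_iff hφ hinv h4, hF.stretch_of_le (by rw [h3, hFs]; linarith), h3, hshift]
      · have h4 : F x - 1 ∈ Icc (0 : ℝ) 1 := ⟨by linarith, by linarith⟩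
        rw [← hshift (F x), ← hF.stretch_mem_iff hφ hinv h4,
          show hF.stretch (F x - 1) = x from hinj (hinj ?_)]
        rw [hF.map_map_stretch_of_le (by rw [hFs]; linarith), hFs]; ring
  have h1 := hmain (Int.fract x) ⟨Int.fract_nonneg x, (Int.fract_lt_one x).le⟩
  have h2 : (x : UnitAddCircle) = (Int.fract x : ℝ) :=
    (unitAddCircle_coe_eq_coe_iff.2 ⟨⌊x⌋, (Int.fract_add_floor x).symm⟩).symm
  rw [h2, ← h1, ← hφ, ← hφ, h2]

end NormalizedLift

/-- every `C²` minimal (`φ` conjugate to doubling) action of the Thompson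
group `T_φ` is ergodic with respect to Lebesgue measure. -/
theorem thompson_minimal_ergodic
    (φ : UnitAddCircle → UnitAddCircle) (F : ℝ → ℝ)
    (hF : IsLiftDeg2 φ F) (hC2 : ContDiff ℝ 2 F) (hpos : ∀ x : ℝ, 0 < deriv F x)
    (h0 : φ 0 = 0) (hd1 : deriv F 0 = 1) (hd2 : deriv (deriv F) 0 = 0)
    (hconj : ConjugateToDoubling φ)
    (A : Set UnitAddCircle) (hA : MeasurableSet A)
    (hinv : ∀ g, InThompsonGroup φ F g → g '' A = A) :
    volume A = 0 ∨ volume A = 1 := by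
  obtain ⟨-, -, hF1, hφF⟩ := hF
  obtain ⟨h, hh⟩ := hconj
  have h00 : ((0 : ℝ) : UnitAddCircle) = (F 0 : ℝ) := by
    rw [← hφF]; exact h0.symm
  obtain ⟨c, hc⟩ := unitAddCircle_coe_eq_coe_iff.1 h00
  rw [zero_add] at hc
  have hG : NormalizedLift fun x => F x - c :=
    { contDiff := hC2.sub contDiff_const
      deriv_pos := fun x => by rw [deriv_sub_const]; exact hpos x
      map_add_one := fun x => by rw [hF1]; ring
      map_zero := by rw [hc, sub_self] }
  set G : ℝ → ℝ := fun x => F x - c with hGdef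
  have hφ : ∀ x : ℝ, φ x = (G x : ℝ) := fun x => by
    rw [hφF]
    exact (unitAddCircle_coe_eq_coe_iff.2 ⟨c, by simp [hGdef]⟩).symm
  have hiter : ∀ n, ∃ d : ℤ, ∀ x, F^[n] x = G^[n] x + d := by
    intro n
    induction n with
    | zero => exact ⟨0, by simp⟩
    | succ n ih =>
      obtain ⟨d, hd⟩ := ih
      refine ⟨2 * d + c, fun x => ?_⟩
      have h1 := hG.map_add_int (G^[n] x) d
      rw [Function.iterate_succ_apply', Function.iterate_succ_apply', hd]
      have h2 : F (G^[n] x + d) = G (G^[n] x + d) + c := by simp [hGdef]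
      rw [h2, h1]
      push_cast; ring
  have hinvG : ∀ g, InThompsonGroup φ G g → g '' A = A := fun g hg =>
    hinv g (hg.of_iterate_eq_add hiter)
  have hmp := UnitAddCircle.measurePreserving_mk 0
  have hnull : ∀ s : Set UnitAddCircle, MeasurableSet s →
      volume ((fun t : ℝ => (t : UnitAddCircle)) ⁻¹' s) = 0 → volume s = 0 := by
    intro s hs h
    rw [← hmp.measure_preimage hs.nullMeasurableSet]
    exact le_antisymm ((Measure.restrict_apply_le _ _).trans h.le) zero_le
  have hAp : ∀ (x : ℝ) (m : ℤ), x + m ∈ (fun t : ℝ => (t : UnitAddCircle)) ⁻¹' A ↔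
      x ∈ (fun t : ℝ => (t : UnitAddCircle)) ⁻¹' A := by
    intro x m
    have : ((x + m : ℝ) : UnitAddCircle) = x :=
      (unitAddCircle_coe_eq_coe_iff.2 ⟨m, rfl⟩).symm
    simp only [mem_preimage, this]
  rcases hG.volume_eq_zero_or_compl hφ h hh
    (hA.preimage (AddCircle.continuous_mk' 1).measurable) hAp
    (fun z hz => (hG.map_mem_iff hφ hinvG z).2 hz) with hz | hz
  · exact Or.inl (hnull A hA hz)
  · right
    have h1 := hnull Aᶜ hA.compl hz
    have h2 := measure_add_measure_compl (μ := volume) hA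
    rwa [h1, add_zero, UnitAddCircle.measure_univ] at h2
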